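/- arXiv:1602.08059 — 2 statements merged into one kernel-verified Lean document; each statement's English description precedes it below -/
import Mathlib

section
/- Let d = 3, let p > 5 be a real number, and let m ≥ 40 be an integer. Then there exists a defocusing potential F : ℝ^m → ℝ that is homogeneous of order p+1, a real number S > 0, and a smooth, nowhere-vanishing function u : Γ₃ → ℝ^m \ {0} on the light cone Γ₃ that solves the nonlinear wave system □u = (∇F)(u) on Γ₃ and is discretely self-similar in the sense that u(e^S t, e^S x) = e^{−(2/(p−1))S} u(t,x) for all (t,x) ∈ Γ₃. -/
open Real MeasureTheory
open scoped RealInnerProductSpace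

noncomputable section

/-- Spacetime `ℝ^{1+d}` realised as `Fin (d+1) → ℝ`; coordinate `0` is the time `t`,
coordinates `i.succ` are the spatial coordinates `x_i`. -/
abbrev Sp (d : ℕ) := Fin (d + 1) → ℝ

/-- The Euclidean target space `ℝ^m`. -/
abbrev Em (m : ℕ) := EuclideanSpace ℝ (Fin m)

/-- The coordinate partial derivative `∂_α`. -/
def pd {d : ℕ} {E : Type*} [NormedAddCommGroup E] [NormedSpace ℝ E]
    (α : Fin (d + 1)) (f : Sp d → E) : Sp d → E :=
  fun x => fderiv ℝ f x (Pi.single α 1)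

/-- The d'Alembertian `□ = -∂_t² + ∑_i ∂_{x_i}²`. -/
def dAlembert {d : ℕ} {E : Type*} [NormedAddCommGroup E] [NormedSpace ℝ E]
    (f : Sp d → E) : Sp d → E :=
  fun x => -(pd 0 (pd 0 f) x) + ∑ i : Fin d, pd i.succ (pd i.succ f) x

/-- The (truncated, solid) light cone `Γ_d = {(t,x) : t > 0, |x| ≤ t}`,
with `|x|` the Euclidean norm. -/
def Cone (d : ℕ) : Set (Sp d) :=
  {y | 0 < y 0 ∧ ∑ i : Fin d, (y i.succ) ^ 2 ≤ (y 0) ^ 2}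

/-- The complex power `t ^ μ` for `t > 0`, written through the real logarithm. -/
def cpw (μ : ℂ) (t : ℝ) : ℂ := Complex.exp (μ * (Real.log t : ℂ))

lemma cpw_add (μ ν : ℂ) (t : ℝ) : cpw (μ + ν) t = cpw μ t * cpw ν t := by
  rw [cpw, cpw, cpw, ← Complex.exp_add, add_mul]

lemma cpw_intCast (n : ℤ) {t : ℝ} (ht : 0 < t) : cpw n t = (t : ℂ) ^ n := by
  rw [cpw, Complex.exp_int_mul, ← Complex.ofReal_exp, Real.exp_log ht]

lemma cpw_ofReal (x : ℝ) {t : ℝ} (ht : 0 < t) : cpw x t = ((t ^ x : ℝ) : ℂ) := by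
  rw [cpw, Real.rpow_def_of_pos ht, Complex.ofReal_exp]
  push_cast
  ring_nf

lemma norm_cpw (μ : ℂ) {t : ℝ} (ht : 0 < t) : ‖cpw μ t‖ = t ^ μ.re := by
  rw [cpw, Complex.norm_exp, Real.rpow_def_of_pos ht]
  simp [mul_comm]

lemma cpw_sub_one (μ : ℂ) {t : ℝ} (ht : 0 < t) : cpw (μ - 1) t = cpw μ t / t := by
  rw [sub_eq_add_neg, cpw_add, show (-1 : ℂ) = ((-1 : ℤ) : ℂ) by simp, cpw_intCast _ ht,
    zpow_neg_one, div_eq_mul_inv]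

lemma cpw_sub_two (μ : ℂ) {t : ℝ} (ht : 0 < t) : cpw (μ - 2) t = cpw μ t / (t : ℂ) ^ 2 := by
  rw [show μ - 2 = μ - 1 - 1 by ring, cpw_sub_one _ ht, cpw_sub_one _ ht, div_div, sq]

lemma cpw_mul (μ : ℂ) {s t : ℝ} (hs : 0 < s) (ht : 0 < t) :
    cpw μ (s * t) = cpw μ s * cpw μ t := by
  rw [cpw, cpw, cpw, ← Complex.exp_add, Real.log_mul hs.ne' ht.ne']
  push_cast
  ring_nf

lemma hasDerivAt_cpw (μ : ℂ) {t : ℝ} (ht : 0 < t) :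
    HasDerivAt (cpw μ) (μ * cpw (μ - 1) t) t := by
  have h := (((Real.hasDerivAt_log ht.ne').ofReal_comp).const_mul μ).cexp
  refine h.congr_deriv ?_
  rw [cpw_sub_one _ ht, cpw]
  push_cast
  ring

lemma contDiffAt_cpw (μ : ℂ) {t : ℝ} (ht : 0 < t) : ContDiffAt ℝ (⊤ : ℕ∞) (cpw μ) t := by
  unfold cpw
  have h : ContDiffAt ℝ (⊤ : ℕ∞) (fun x : ℝ => ((Real.log x : ℝ) : ℂ)) t :=
    Complex.ofRealCLM.contDiff.contDiffAt.comp t (Real.contDiffAt_log.2 ht.ne')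
  exact (contDiffAt_const.mul h).cexp

/-- The squared spatial radius in units of time. -/
def simVar (y : Sp 3) : ℝ := (∑ i : Fin 3, (y i.succ) ^ 2) / (y 0) ^ 2

/-- The self-similar profile `t ^ μ f (|x|² / t²)`. -/
def profile (μ : ℂ) (f : ℝ → ℂ) (y : Sp 3) : ℂ := cpw μ (y 0) * f (simVar y)

lemma contDiffAt_simVar {y : Sp 3} (hy : 0 < y 0) : ContDiffAt ℝ (⊤ : ℕ∞) simVar y := by
  unfold simVar
  have h : (y 0) ^ 2 ≠ 0 := by positivity
  refine ContDiffAt.div ?_ ?_ h <;> fun_prop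

lemma contDiffAt_profile (μ : ℂ) {f : ℝ → ℂ} (hf : ContDiff ℝ (⊤ : ℕ∞) f) {y : Sp 3}
    (hy : 0 < y 0) : ContDiffAt ℝ (⊤ : ℕ∞) (profile μ f) y := by
  have h0 : ContDiffAt ℝ (⊤ : ℕ∞) (fun y : Sp 3 => y 0) y := by fun_prop
  have h1 : ContDiffAt ℝ (⊤ : ℕ∞) (fun y : Sp 3 => cpw μ (y 0)) y :=
    ContDiffAt.comp (g := cpw μ) y (contDiffAt_cpw μ hy) h0
  exact h1.mul (hf.contDiffAt.comp y (contDiffAt_simVar hy))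

lemma pd_eq_of_hasDerivAt {E : Type*} [NormedAddCommGroup E] [NormedSpace ℝ E] {d : ℕ}
    {f : Sp d → E} {y : Sp d} {α : Fin (d + 1)} {v : E} (hf : DifferentiableAt ℝ f y)
    (h : HasDerivAt (fun s : ℝ => f (y + s • (Pi.single α 1 : Sp d))) v 0) : pd α f y = v := by
  have h1 : HasLineDerivAt ℝ f v y (Pi.single α 1) := h
  exact (hf.hasFDerivAt.hasLineDerivAt _).unique h1

lemma pd_zero_profile (μ : ℂ) {f : ℝ → ℂ} (hf : ContDiff ℝ (⊤ : ℕ∞) f) {y : Sp 3}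
    (hy : 0 < y 0) :
    pd 0 (profile μ f) y = profile (μ - 1) (fun s => μ * f s - 2 * s * deriv f s) y := by
  refine pd_eq_of_hasDerivAt ((contDiffAt_profile μ hf hy).differentiableAt (by simp)) ?_
  have hline : (fun s : ℝ => profile μ f (y + s • (Pi.single 0 1 : Sp 3))) =
      fun s : ℝ => cpw μ (y 0 + s) * f ((∑ i : Fin 3, (y i.succ) ^ 2) / (y 0 + s) ^ 2) := by
    ext s
    simp [profile, simVar]
  rw [hline]
  set c := ∑ i : Fin 3, (y i.succ) ^ 2 with hc
  have ht : HasDerivAt (fun s : ℝ => y 0 + s) 1 0 := (hasDerivAt_id _).const_add _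
  have h1 : HasDerivAt (fun s : ℝ => cpw μ (y 0 + s)) (μ * cpw (μ - 1) (y 0)) 0 := by
    refine (HasDerivAt.scomp (g₁ := cpw μ) (x := (0 : ℝ))
      (g₁' := μ * cpw (μ - 1) (y 0)) ?_ ht).congr_deriv (one_smul ℝ _)
    simpa using hasDerivAt_cpw μ hy
  have h2 : HasDerivAt (fun s : ℝ => c / (y 0 + s) ^ 2) (-2 * c / (y 0) ^ 3) 0 := by
    have h := (hasDerivAt_const (0 : ℝ) c).div (ht.pow 2) (by simpa using hy.ne')
    refine h.congr_deriv ?_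
    simp
    field_simp
  have h3 : HasDerivAt (fun s : ℝ => f (c / (y 0 + s) ^ 2))
      ((-2 * c / (y 0) ^ 3) • deriv f (c / (y 0) ^ 2)) 0 := by
    refine HasDerivAt.scomp (g₁ := f) (x := (0 : ℝ)) ?_ h2
    simpa using ((hf.differentiable (by simp)) _).hasDerivAt
  refine (h1.mul h3).congr_deriv ?_
  have hy' : ((y 0 : ℝ) : ℂ) ≠ 0 := by exact_mod_cast hy.ne'
  simp only [profile, simVar, ← hc, add_zero, Complex.real_smul]
  rw [cpw_sub_one _ hy]
  push_cast
  field_simp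
  ring

lemma pd_succ_profile (μ : ℂ) {f : ℝ → ℂ} (hf : ContDiff ℝ (⊤ : ℕ∞) f) {y : Sp 3}
    (hy : 0 < y 0) (i : Fin 3) :
    pd i.succ (profile μ f) y = y i.succ * profile (μ - 2) (fun s => 2 * deriv f s) y := by
  refine pd_eq_of_hasDerivAt ((contDiffAt_profile μ hf hy).differentiableAt (by simp)) ?_
  have hline : (fun s : ℝ => profile μ f (y + s • (Pi.single i.succ 1 : Sp 3))) =
      fun s : ℝ => cpw μ (y 0) *
        f (((∑ i : Fin 3, (y i.succ) ^ 2) + (2 * y i.succ * s + s ^ 2)) / (y 0) ^ 2) := by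
    ext s
    fin_cases i <;> simp [profile, simVar, Fin.sum_univ_three] <;> ring_nf <;> simp
  rw [hline]
  set c := ∑ i : Fin 3, (y i.succ) ^ 2 with hc
  have h2 : HasDerivAt (fun s : ℝ => (c + (2 * y i.succ * s + s ^ 2)) / (y 0) ^ 2)
      (2 * y i.succ / (y 0) ^ 2) 0 := by
    have h := ((((hasDerivAt_id (0 : ℝ)).const_mul (2 * y i.succ)).add
      ((hasDerivAt_id (0 : ℝ)).pow 2)).const_add c).div_const ((y 0) ^ 2)
    refine h.congr_deriv ?_
    simp
  have h3 : HasDerivAt (fun s : ℝ => f ((c + (2 * y i.succ * s + s ^ 2)) / (y 0) ^ 2))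
      ((2 * y i.succ / (y 0) ^ 2) • deriv f (c / (y 0) ^ 2)) 0 := by
    refine HasDerivAt.scomp (g₁ := f) (x := (0 : ℝ)) ?_ h2
    simpa using ((hf.differentiable (by simp)) _).hasDerivAt
  refine (h3.const_mul _).congr_deriv ?_
  have hy' : ((y 0 : ℝ) : ℂ) ≠ 0 := by exact_mod_cast hy.ne'
  simp only [profile, simVar, ← hc, Complex.real_smul]
  rw [cpw_sub_two _ hy]
  push_cast
  field_simp

/-- The radial operator induced on profiles by the d'Alembertian. -/
def boxOp (μ : ℂ) (f : ℝ → ℂ) (s : ℝ) : ℂ :=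
  -(μ * (μ - 1)) * f s + ((4 * μ - 6) * s + 6) * deriv f s + 4 * s * (1 - s) * deriv (deriv f) s

lemma contDiff_deriv {E : Type*} [NormedAddCommGroup E] [NormedSpace ℝ E] {f : ℝ → E} (hf : ContDiff ℝ (⊤ : ℕ∞) f) :
    ContDiff ℝ (⊤ : ℕ∞) (deriv f) :=
  (contDiff_infty_iff_deriv.1 hf).2

lemma contDiff_ofReal : ContDiff ℝ (⊤ : ℕ∞) (fun s : ℝ => (s : ℂ)) :=
  Complex.ofRealCLM.contDiff

lemma pd_congr {E : Type*} [NormedAddCommGroup E] [NormedSpace ℝ E]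
    {f g : Sp 3 → E} {y : Sp 3} (hy : 0 < y 0) (h : ∀ y : Sp 3, 0 < y 0 → f y = g y)
    (α : Fin 4) : pd α f y = pd α g y := by
  have ho : IsOpen {y : Sp 3 | 0 < y 0} := isOpen_lt continuous_const (continuous_apply 0)
  have : f =ᶠ[nhds y] g := Filter.mem_of_superset (ho.mem_nhds hy) fun x hx => h x hx
  rw [pd, pd, this.fderiv_eq]

lemma dAlembert_profile (μ : ℂ) {f : ℝ → ℂ} (hf : ContDiff ℝ (⊤ : ℕ∞) f) {y : Sp 3}
    (hy : 0 < y 0) : dAlembert (profile μ f) y = profile (μ - 2) (boxOp μ f) y := by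
  have hf1 := contDiff_deriv hf
  have hf2 := contDiff_deriv hf1
  have h0 : pd 0 (pd 0 (profile μ f)) y = profile (μ - 2) (fun s => (μ - 1) *
      (μ * f s - 2 * s * deriv f s) -
      2 * s * (μ * deriv f s - 2 * deriv f s - 2 * s * deriv (deriv f) s)) y := by
    have hg : ContDiff ℝ (⊤ : ℕ∞) (fun s : ℝ => μ * f s - 2 * s * deriv f s) :=
      (contDiff_const.mul hf).sub ((contDiff_const.mul contDiff_ofReal).mul hf1)
    rw [pd_congr hy (fun y hy => pd_zero_profile μ hf hy), pd_zero_profile _ hg hy,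
      show μ - 1 - 1 = μ - 2 by ring]
    congr 1
    ext s
    have h1 := ((hf.differentiable (by simp)) s).hasDerivAt
    have h2 := ((hf1.differentiable (by simp)) s).hasDerivAt
    have h3 : HasDerivAt (fun s : ℝ => (s : ℂ)) 1 s := Complex.ofRealCLM.hasDerivAt
    have h4 : HasDerivAt (fun s : ℝ => μ * f s - 2 * s * deriv f s) _ s :=
      (h1.const_mul μ).sub ((h3.const_mul 2).mul h2)
    rw [h4.deriv]
    ring
  have hi : ∀ i : Fin 3, pd i.succ (pd i.succ (profile μ f)) y =
      profile (μ - 2) (fun s => 2 * deriv f s) y +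
        (y i.succ : ℂ) ^ 2 * profile (μ - 2 - 2) (fun s => 4 * deriv (deriv f) s) y := by
    intro i
    have hg : ContDiff ℝ (⊤ : ℕ∞) (fun s : ℝ => 2 * deriv f s) := contDiff_const.mul hf1
    rw [pd_congr hy (fun y hy => pd_succ_profile μ hf hy i)]
    have hd := ((contDiffAt_profile (μ - 2) hg hy).differentiableAt (by simp)).hasFDerivAt
    have hc : HasFDerivAt (fun y : Sp 3 => ((y i.succ : ℝ) : ℂ))
        (Complex.ofRealCLM.comp (ContinuousLinearMap.proj i.succ)) y :=
      (Complex.ofRealCLM.comp (ContinuousLinearMap.proj (R := ℝ) (φ := fun _ => ℝ)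
        i.succ)).hasFDerivAt
    have hp := pd_succ_profile (μ - 2) hg hy i
    rw [pd] at hp ⊢
    have hm : HasFDerivAt (fun y : Sp 3 => (y i.succ : ℂ) *
        profile (μ - 2) (fun s => 2 * deriv f s) y) _ y := hc.mul hd
    rw [hm.fderiv]
    simp only [add_apply, smul_apply, hp]
    have h2 : deriv (fun s => 2 * deriv f s) = fun s => 2 * deriv (deriv f) s := by
      ext s
      exact (((hf1.differentiable (by simp)) s).hasDerivAt.const_mul 2).deriv
    simp [h2]
    simp only [profile]
    ring
  rw [dAlembert, h0, Finset.sum_congr rfl (fun i _ => hi i), Finset.sum_add_distrib,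
    ← Finset.sum_mul]
  have hs : (∑ i : Fin 3, (y i.succ : ℂ) ^ 2) = simVar y * (y 0 : ℂ) ^ 2 := by
    have : (∑ i : Fin 3, (y i.succ) ^ 2) = simVar y * (y 0) ^ 2 := by
      rw [simVar, div_mul_cancel₀ _ (by positivity)]
    exact_mod_cast congrArg (fun r : ℝ => (r : ℂ)) this
  have hy' : ((y 0 : ℝ) : ℂ) ≠ 0 := by exact_mod_cast hy.ne'
  rw [hs]
  simp only [profile, boxOp, Finset.sum_const, Finset.card_univ, Fintype.card_fin,
    cpw_sub_two _ hy]
  field_simp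
  simp only [nsmul_eq_mul]
  push_cast
  field_simp
  ring

/-- A positive function on `{c 0 ≠ 0} ⊆ ℂ⁴`, homogeneous of degree `r`, invariant under the
simultaneous rotation of `c 0` and `c 2`, whose value along the curve `(1, z, g z, h z)` is
`φ z` and whose derivatives across this curve are governed by `k` and `l`. -/
def conePot (r : ℝ) (φ : ℝ → ℝ) (k g l h : ℝ → ℂ) (c : Fin 4 → ℂ) : ℝ :=
  ‖c 0‖ ^ r * φ ((c 1).re / ‖c 0‖) *
    Real.exp ((star (k ((c 1).re / ‖c 0‖)) * (c 2 / c 0 - g ((c 1).re / ‖c 0‖))).re +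
      (star (l ((c 1).re / ‖c 0‖)) * (c 3 / ‖c 0‖ - h ((c 1).re / ‖c 0‖))).re)

lemma conePot_pos {r : ℝ} {φ : ℝ → ℝ} (hφ : ∀ x, 0 < φ x) (k g l h : ℝ → ℂ) {c : Fin 4 → ℂ}
    (hc : c 0 ≠ 0) : 0 < conePot r φ k g l h c :=
  mul_pos (mul_pos (Real.rpow_pos_of_pos (norm_pos_iff.2 hc) _) (hφ _)) (Real.exp_pos _)

lemma conePot_twist (r : ℝ) (φ : ℝ → ℝ) (k g l h : ℝ → ℂ) {e : ℂ} (he : e ≠ 0) (c : Fin 4 → ℂ) :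
    conePot r φ k g l h ![e * c 0, ‖e‖ * c 1, e * c 2, ‖e‖ * c 3] =
      ‖e‖ ^ r * conePot r φ k g l h c := by
  have hn : ‖e‖ ≠ 0 := norm_ne_zero_iff.2 he
  have hn' : (‖e‖ : ℂ) ≠ 0 := by exact_mod_cast hn
  have h1 : ((‖e‖ : ℂ) * c 1).re / ‖e * c 0‖ = (c 1).re / ‖c 0‖ := by
    rw [norm_mul, Complex.re_ofReal_mul, mul_div_mul_left _ _ hn]
  have h2 : e * c 2 / (e * c 0) = c 2 / c 0 := mul_div_mul_left _ _ he
  have h3 : (‖e‖ : ℂ) * c 3 / (‖e * c 0‖ : ℝ) = c 3 / ‖c 0‖ := by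
    rw [norm_mul, Complex.ofReal_mul, mul_div_mul_left _ _ hn']
  simp only [conePot, Matrix.cons_val_zero, Matrix.cons_val_one, Matrix.cons_val, h1, h2, h3]
  rw [norm_mul, Real.mul_rpow (norm_nonneg _) (norm_nonneg _)]
  ring

lemma conePot_smul (r : ℝ) (φ : ℝ → ℝ) (k g l h : ℝ → ℂ) {s : ℝ} (hs : 0 < s) (c : Fin 4 → ℂ) :
    conePot r φ k g l h (s • c) = s ^ r * conePot r φ k g l h c := by
  have hn : ‖(s : ℂ)‖ = s := by simp [abs_of_pos hs]
  have := conePot_twist r φ k g l h (e := s) (by exact_mod_cast hs.ne') c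
  rw [hn] at this
  rw [← this]
  congr 1
  ext i
  fin_cases i <;> simp

lemma contDiffAt_conePot (r : ℝ) {φ : ℝ → ℝ} {k g l h : ℝ → ℂ} (hφ : ContDiff ℝ (⊤ : ℕ∞) φ)
    (hk : ContDiff ℝ (⊤ : ℕ∞) k) (hg : ContDiff ℝ (⊤ : ℕ∞) g) (hl : ContDiff ℝ (⊤ : ℕ∞) l)
    (hh : ContDiff ℝ (⊤ : ℕ∞) h) {c : Fin 4 → ℂ} (hc : c 0 ≠ 0) :
    ContDiffAt ℝ (⊤ : ℕ∞) (conePot r φ k g l h) c := by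
  have hp : ∀ i : Fin 4, ContDiffAt ℝ (⊤ : ℕ∞) (fun c : Fin 4 → ℂ => c i) c :=
    fun i => by fun_prop
  have hre : ∀ {f : (Fin 4 → ℂ) → ℂ}, ContDiffAt ℝ (⊤ : ℕ∞) f c →
      ContDiffAt ℝ (⊤ : ℕ∞) (fun c => (f c).re) c :=
    fun hf => Complex.reCLM.contDiff.contDiffAt.comp c hf
  have hcoe : ∀ {f : (Fin 4 → ℂ) → ℝ}, ContDiffAt ℝ (⊤ : ℕ∞) f c →
      ContDiffAt ℝ (⊤ : ℕ∞) (fun c => (f c : ℂ)) c :=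
    fun hf => Complex.ofRealCLM.contDiff.contDiffAt.comp c hf
  have hst : ∀ {f : (Fin 4 → ℂ) → ℂ}, ContDiffAt ℝ (⊤ : ℕ∞) f c →
      ContDiffAt ℝ (⊤ : ℕ∞) (fun c => star (f c)) c :=
    fun hf => Complex.conjCLE.contDiff.contDiffAt.comp c hf
  have hn : ContDiffAt ℝ (⊤ : ℕ∞) (fun c : Fin 4 → ℂ => ‖c 0‖) c := (hp 0).norm ℝ hc
  have hn0 : ‖c 0‖ ≠ 0 := norm_ne_zero_iff.2 hc
  have hσ : ContDiffAt ℝ (⊤ : ℕ∞) (fun c : Fin 4 → ℂ => (c 1).re / ‖c 0‖) c :=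
    (hre (hp 1)).div hn hn0
  have hcomp : ∀ {f : ℝ → ℂ}, ContDiff ℝ (⊤ : ℕ∞) f →
      ContDiffAt ℝ (⊤ : ℕ∞) (fun c : Fin 4 → ℂ => f ((c 1).re / ‖c 0‖)) c :=
    fun hf => hf.contDiffAt.comp c hσ
  have hdiv : ∀ {f e : (Fin 4 → ℂ) → ℂ}, ContDiffAt ℝ (⊤ : ℕ∞) f c →
      ContDiffAt ℝ (⊤ : ℕ∞) e c → e c ≠ 0 → ContDiffAt ℝ (⊤ : ℕ∞) (fun c => f c / e c) c :=
    fun hf he h0 => by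
      simp only [div_eq_mul_inv]
      exact hf.mul (he.inv h0)
  unfold conePot
  refine ((hn.rpow_const_of_ne hn0).mul (hφ.contDiffAt.comp c hσ)).mul ((ContDiffAt.add
    (hre ((hst (hcomp hk)).mul ((hdiv (hp 2) (hp 0) hc).sub (hcomp hg))))
    (hre ((hst (hcomp hl)).mul ((hdiv (hp 3) (hcoe hn) ?_).sub (hcomp hh))))).exp)
  exact_mod_cast hn0

lemma hasDerivAt_re_star_mul {κ w : ℝ → ℂ} {w' : ℂ} {x : ℝ} (hκ : DifferentiableAt ℝ κ x)
    (hw : HasDerivAt w w' x) (h0 : w x = 0) :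
    HasDerivAt (fun s => (star (κ s) * w s).re) (star (κ x) * w').re x := by
  have h1 : HasDerivAt (fun s => star (κ s)) (star (deriv κ x)) x := hκ.hasDerivAt.star
  have h2 := Complex.reCLM.hasFDerivAt.comp_hasDerivAt x (h1.mul hw)
  refine h2.congr_deriv ?_
  simp [h0]

lemma hasDerivAt_conePot (r : ℝ) {φ : ℝ → ℝ} {k g l h : ℝ → ℂ} (hφ : Differentiable ℝ φ)
    (hk : Differentiable ℝ k) (hg : Differentiable ℝ g) (hl : Differentiable ℝ l)
    (hh : Differentiable ℝ h) (z : ℝ) (ζ : Fin 4 → ℂ) :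
    HasDerivAt (fun s : ℝ => conePot r φ k g l h (![1, (z : ℂ), g z, h z] + s • ζ))
      (r * (ζ 0).re * φ z + deriv φ z * ((ζ 1).re - z * (ζ 0).re) + φ z *
        ((star (k z) * (ζ 2 - g z * ζ 0 - ((ζ 1).re - z * (ζ 0).re : ℝ) * deriv g z)).re +
         (star (l z) * (ζ 3 - h z * (ζ 0).re -
          ((ζ 1).re - z * (ζ 0).re : ℝ) * deriv h z)).re)) 0 := by
  have hlin : ∀ b ζ : ℂ, HasDerivAt (fun s : ℝ => b + s * ζ) ζ 0 := by
    intro b ζ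
    have h1 : HasDerivAt (fun s : ℝ => (s : ℂ)) 1 0 := Complex.ofRealCLM.hasDerivAt
    simpa using (h1.mul_const ζ).const_add b
  have hre : ∀ b ζ : ℂ, HasDerivAt (fun s : ℝ => (b + s * ζ).re) ζ.re 0 := fun b ζ =>
    Complex.reCLM.hasFDerivAt.comp_hasDerivAt 0 (hlin b ζ)
  have him : ∀ b ζ : ℂ, HasDerivAt (fun s : ℝ => (b + s * ζ).im) ζ.im 0 := fun b ζ =>
    Complex.imCLM.hasFDerivAt.comp_hasDerivAt 0 (hlin b ζ)
  have hn : HasDerivAt (fun s : ℝ => ‖1 + s * ζ 0‖) (ζ 0).re 0 := by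
    have h1 : HasDerivAt (fun s : ℝ => √((1 + s * ζ 0).re * (1 + s * ζ 0).re +
        (1 + s * ζ 0).im * (1 + s * ζ 0).im)) _ 0 :=
      (((hre 1 (ζ 0)).mul (hre 1 (ζ 0))).add ((him 1 (ζ 0)).mul (him 1 (ζ 0)))).sqrt (by simp)
    refine (h1.congr_deriv ?_).congr_of_eventuallyEq (Filter.Eventually.of_forall fun s => ?_)
    · simp
    · exact Complex.norm_def _
  have hnc : HasDerivAt (fun s : ℝ => ((‖1 + s * ζ 0‖ : ℝ) : ℂ)) ((ζ 0).re : ℂ) 0 :=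
    hn.ofReal_comp
  have hσ : HasDerivAt (fun s : ℝ => ((z : ℂ) + s * ζ 1).re / ‖1 + s * ζ 0‖)
      ((ζ 1).re - z * (ζ 0).re) 0 := by
    refine ((hre z (ζ 1)).div hn (by simp)).congr_deriv ?_
    simp
  have hσ0 : ((z : ℂ) + (0 : ℝ) * ζ 1).re / ‖1 + (0 : ℝ) * ζ 0‖ = z := by simp
  have hcomp : ∀ {f : ℝ → ℂ}, Differentiable ℝ f →
      HasDerivAt (fun s : ℝ => f (((z : ℂ) + s * ζ 1).re / ‖1 + s * ζ 0‖))
        (((ζ 1).re - z * (ζ 0).re : ℝ) * deriv f z) 0 := by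
    intro f hf
    rw [← Complex.real_smul]
    refine HasDerivAt.scomp (g₁ := f) (x := (0 : ℝ)) ?_ hσ
    rw [hσ0]
    exact (hf z).hasDerivAt
  have hφσ : HasDerivAt (fun s : ℝ => φ (((z : ℂ) + s * ζ 1).re / ‖1 + s * ζ 0‖))
      (deriv φ z * ((ζ 1).re - z * (ζ 0).re)) 0 := by
    refine HasDerivAt.comp (h₂ := φ) (x := (0 : ℝ)) ?_ hσ
    rw [hσ0]
    exact (hφ z).hasDerivAt
  have h2 : HasDerivAt (fun s : ℝ => (g z + s * ζ 2) / (1 + s * ζ 0) -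
      g (((z : ℂ) + s * ζ 1).re / ‖1 + s * ζ 0‖))
      (ζ 2 - g z * ζ 0 - ((ζ 1).re - z * (ζ 0).re : ℝ) * deriv g z) 0 := by
    refine (((hlin (g z) (ζ 2)).div (hlin 1 (ζ 0)) (by simp)).sub (hcomp hg)).congr_deriv ?_
    simp
  have h3 : HasDerivAt (fun s : ℝ => (h z + s * ζ 3) / ((‖1 + s * ζ 0‖ : ℝ) : ℂ) -
      h (((z : ℂ) + s * ζ 1).re / ‖1 + s * ζ 0‖))
      (ζ 3 - h z * (ζ 0).re - ((ζ 1).re - z * (ζ 0).re : ℝ) * deriv h z) 0 := by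
    refine (((hlin (h z) (ζ 3)).div hnc (by simp)).sub (hcomp hh)).congr_deriv ?_
    simp
  have hE2 := hasDerivAt_re_star_mul (hcomp hk).differentiableAt h2 (by simp)
  have hE3 := hasDerivAt_re_star_mul (hcomp hl).differentiableAt h3 (by simp)
  have hN : HasDerivAt (fun s : ℝ => ‖1 + s * ζ 0‖ ^ r) (r * (ζ 0).re) 0 := by
    refine (hn.rpow_const (p := r) (by simp)).congr_deriv ?_
    simp
    ring
  have hmain := (hN.mul hφσ).mul (hE2.add hE3).exp
  refine (hmain.congr_deriv ?_).congr_of_eventuallyEq (Filter.Eventually.of_forall fun s => ?_)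
  · simp only [Pi.add_apply, Pi.mul_apply, hσ0]
    simp
  · simp [conePot]

lemma exists_isometric_coordinates {m : ℕ} (hm : 8 ≤ m) :
    ∃ (T : (Fin 4 → ℂ) →L[ℝ] Em m) (P : Em m →L[ℝ] (Fin 4 → ℂ)), (∀ c, P (T c) = c) ∧
      ∀ c v, ⟪T c, v⟫ = ∑ j, (star (c j) * P v j).re := by
  let i : Fin 8 → Fin m := Fin.castLE hm
  have hi : Function.Injective i := Fin.castLE_injective hm
  let b : Fin m → Em m := fun j => EuclideanSpace.single j 1
  let re : Fin 4 → Fin 8 := ![0, 2, 4, 6]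
  let im : Fin 4 → Fin 8 := ![1, 3, 5, 7]
  let T₀ : (Fin 4 → ℂ) →ₗ[ℝ] Em m :=
    { toFun := fun c => ∑ j, ((c j).re • b (i (re j)) + (c j).im • b (i (im j)))
      map_add' := fun c d => by
        rw [← Finset.sum_add_distrib]
        refine Finset.sum_congr rfl fun j _ => ?_
        simp only [Pi.add_apply, Complex.add_re, Complex.add_im]
        module
      map_smul' := fun s c => by
        rw [RingHom.id_apply, Finset.smul_sum]
        refine Finset.sum_congr rfl fun j _ => ?_
        simp only [Pi.smul_apply, Complex.smul_re, Complex.smul_im, smul_eq_mul]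
        module }
  let P₀ : Em m →ₗ[ℝ] (Fin 4 → ℂ) :=
    { toFun := fun v j => ⟨v (i (re j)), v (i (im j))⟩
      map_add' := fun v w => by ext j; apply Complex.ext <;> simp
      map_smul' := fun s v => by ext j; apply Complex.ext <;> simp }
  refine ⟨LinearMap.toContinuousLinearMap T₀, LinearMap.toContinuousLinearMap P₀, ?_, ?_⟩
  · intro c
    ext j
    fin_cases j <;> apply Complex.ext <;>
      simp [T₀, P₀, b, re, im, Fin.sum_univ_four, hi.eq_iff]
  · intro c v
    simp [T₀, P₀, b, sum_inner, inner_add_left, inner_smul_left, EuclideanSpace.inner_single_left]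

lemma hasLineDerivAt_conePot {r : ℝ} {φ : ℝ → ℝ} {k g l h : ℝ → ℂ} (hφ : Differentiable ℝ φ)
    (hk : Differentiable ℝ k) (hg : Differentiable ℝ g) (hl : Differentiable ℝ l)
    (hh : Differentiable ℝ h) {z : ℝ} {Z₀ Z₁ Z₂ Z₃ : ℂ} (hkZ : φ z * k z = Z₂)
    (hlZ : φ z * l z = Z₃)
    (h0 : Z₀.re + z * Z₁.re + (star (g z) * Z₂).re + (star (h z) * Z₃).re = r * φ z)
    (h1 : Z₀.im + (star (g z) * Z₂).im = 0) (hZ₁ : Z₁.im = 0)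
    (h2 : Z₁.re + (star (deriv g z) * Z₂).re + (star (deriv h z) * Z₃).re = deriv φ z)
    {e : ℂ} (he : e ≠ 0) (ξ : Fin 4 → ℂ) :
    HasLineDerivAt ℝ (conePot r φ k g l h)
      (‖e‖ ^ r * (star Z₀ * (ξ 0 / e) + star Z₁ * (ξ 1 / ‖e‖) + star Z₂ * (ξ 2 / e) +
        star Z₃ * (ξ 3 / ‖e‖)).re) ![e, ‖e‖ * z, e * g z, ‖e‖ * h z] ξ := by
  have hn : (‖e‖ : ℂ) ≠ 0 := by exact_mod_cast norm_ne_zero_iff.2 he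
  have hd := (hasDerivAt_conePot r hφ hk hg hl hh z
    ![ξ 0 / e, ξ 1 / ‖e‖, ξ 2 / e, ξ 3 / ‖e‖]).const_mul (‖e‖ ^ r)
  refine (hd.congr_deriv ?_).congr_of_eventuallyEq (Filter.Eventually.of_forall fun s => ?_)
  · congr 1
    simp only [Matrix.cons_val_zero, Matrix.cons_val_one, Matrix.cons_val]
    generalize ξ 0 / e = a
    generalize ξ 1 / (‖e‖ : ℂ) = b
    generalize ξ 2 / e = c
    generalize ξ 3 / (‖e‖ : ℂ) = d
    subst hkZ hlZ
    simp only [Complex.star_def, Complex.mul_re, Complex.mul_im, Complex.conj_re, Complex.conj_im,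
      Complex.sub_re, Complex.sub_im, Complex.ofReal_re, Complex.ofReal_im, Complex.add_re] at *
    simp only [zero_mul, sub_zero, add_zero, mul_zero] at *
    rw [hZ₁]
    linear_combination (-a.re) * h0 - a.im * h1 - (b.re - z * a.re) * h2
  · simp only
    rw [← conePot_twist _ _ _ _ _ _ he]
    congr 1
    ext i
    fin_cases i <;> simp <;> field_simp

/-- The cutoff equal to `0` on `[0, κ / 2]` and to `1` on `[κ, ∞)`. -/
def coneCutoff (κ x : ℝ) : ℝ := Real.smoothTransition (2 * x / κ - 1)

lemma coneCutoff_nonneg (κ x : ℝ) : 0 ≤ coneCutoff κ x := Real.smoothTransition.nonneg _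

lemma coneCutoff_le_one (κ x : ℝ) : coneCutoff κ x ≤ 1 := Real.smoothTransition.le_one _

lemma coneCutoff_eq_zero {κ x : ℝ} (hκ : 0 < κ) (hx : x ≤ κ / 2) : coneCutoff κ x = 0 := by
  refine Real.smoothTransition.zero_of_nonpos ?_
  rw [sub_nonpos, div_le_one hκ]
  linarith

lemma coneCutoff_eq_one {κ x : ℝ} (hκ : 0 < κ) (hx : κ ≤ x) : coneCutoff κ x = 1 := by
  refine Real.smoothTransition.one_of_one_le ?_
  rw [le_sub_iff_add_le, le_div_iff₀ hκ]
  linarith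

lemma contDiff_coneCutoff (κ : ℝ) : ContDiff ℝ (⊤ : ℕ∞) (coneCutoff κ) := by
  unfold coneCutoff
  exact Real.smoothTransition.contDiff.comp
    (((contDiff_const.mul contDiff_id).div_const κ).sub contDiff_const)

/-- The potential equal to `Q ∘ P` on the cone `κ ‖v‖² ≤ ‖P v 0‖²` and to `‖v‖ ^ r` away from it. -/
def gluedPot {m : ℕ} (P : Em m →L[ℝ] (Fin 4 → ℂ)) (κ r : ℝ) (Q : (Fin 4 → ℂ) → ℝ) (v : Em m) : ℝ :=
  coneCutoff κ (‖P v 0‖ ^ 2 / ‖v‖ ^ 2) * Q (P v) +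
    (1 - coneCutoff κ (‖P v 0‖ ^ 2 / ‖v‖ ^ 2)) * ‖v‖ ^ r

section gluedPot

variable {m : ℕ} {P : Em m →L[ℝ] (Fin 4 → ℂ)} {κ r : ℝ} {Q : (Fin 4 → ℂ) → ℝ}

lemma gluedPot_pos (hκ : 0 < κ) (hQ : ∀ c : Fin 4 → ℂ, c 0 ≠ 0 → 0 < Q c) {v : Em m}
    (hv : v ≠ 0) : 0 < gluedPot P κ r Q v := by
  have hr : 0 < ‖v‖ ^ r := Real.rpow_pos_of_pos (norm_pos_iff.2 hv) r
  unfold gluedPot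
  by_cases h0 : P v 0 = 0
  · rw [h0, norm_zero, coneCutoff_eq_zero hκ (by simp; positivity)]
    simpa using hr
  · have h1 := coneCutoff_nonneg κ (‖P v 0‖ ^ 2 / ‖v‖ ^ 2)
    have h2 := coneCutoff_le_one κ (‖P v 0‖ ^ 2 / ‖v‖ ^ 2)
    have h3 := hQ _ h0
    generalize coneCutoff κ (‖P v 0‖ ^ 2 / ‖v‖ ^ 2) = x at *
    rcases h1.eq_or_lt with rfl | h1
    · simpa using hr
    · have := mul_pos h1 h3
      have := mul_nonneg (sub_nonneg.2 h2) hr.le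
      linarith

lemma gluedPot_smul (hQ : ∀ l : ℝ, 0 < l → ∀ c, Q (l • c) = l ^ r * Q c) {l : ℝ} (hl : 0 < l)
    (v : Em m) : gluedPot P κ r Q (l • v) = l ^ r * gluedPot P κ r Q v := by
  have h1 : ‖P (l • v) 0‖ ^ 2 / ‖l • v‖ ^ 2 = ‖P v 0‖ ^ 2 / ‖v‖ ^ 2 := by
    rw [map_smul, Pi.smul_apply, norm_smul, norm_smul, mul_pow, mul_pow,
      mul_div_mul_left _ _ (by simpa using hl.ne')]
  unfold gluedPot
  rw [h1, map_smul, hQ l hl, norm_smul, Real.norm_of_nonneg hl.le,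
    Real.mul_rpow hl.le (norm_nonneg v)]
  ring

lemma continuousAt_gluedPot_ratio {v : Em m} (hv : v ≠ 0) :
    ContinuousAt (fun v => ‖P v 0‖ ^ 2 / ‖v‖ ^ 2) v := by
  have h0 : ContinuousAt (fun v => P v 0) v :=
    ((continuous_apply 0).comp P.continuous).continuousAt
  exact (h0.norm.pow 2).div (continuousAt_id.norm.pow 2) (by simpa using hv)

lemma contDiffAt_gluedPot (hκ : 0 < κ)
    (hQ : ∀ c : Fin 4 → ℂ, c 0 ≠ 0 → ContDiffAt ℝ (⊤ : ℕ∞) Q c) {v : Em m}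
    (hv : v ≠ 0) : ContDiffAt ℝ (⊤ : ℕ∞) (gluedPot P κ r Q) v := by
  have hnorm : ContDiffAt ℝ (⊤ : ℕ∞) (fun v : Em m => ‖v‖) v := contDiffAt_id.norm ℝ hv
  have hpow := hnorm.rpow_const_of_ne (p := r) (norm_ne_zero_iff.2 hv)
  by_cases h0 : P v 0 = 0
  · refine hpow.congr_of_eventuallyEq ?_
    have hlim := (continuousAt_gluedPot_ratio (P := P) hv).eventually_lt continuousAt_const
      (show ‖P v 0‖ ^ 2 / ‖v‖ ^ 2 < κ / 2 by simpa [h0] using hκ)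
    filter_upwards [hlim] with w hw
    rw [gluedPot, coneCutoff_eq_zero hκ hw.le]
    ring
  · have hP : ContDiffAt ℝ (⊤ : ℕ∞) (fun v => P v) v := P.contDiff.contDiffAt
    have hP0 : ContDiffAt ℝ (⊤ : ℕ∞) (fun v => P v 0) v := contDiffAt_pi.1 hP 0
    have hratio : ContDiffAt ℝ (⊤ : ℕ∞) (fun v => ‖P v 0‖ ^ 2 / ‖v‖ ^ 2) v :=
      ((hP0.norm ℝ h0).pow 2).div (hnorm.pow 2) (by simpa using hv)
    have hcut := (contDiff_coneCutoff κ).contDiffAt.comp v hratio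
    exact (hcut.mul ((hQ _ h0).comp v hP)).add ((contDiffAt_const.sub hcut).mul hpow)

lemma gluedPot_eventuallyEq (hκ : 0 < κ) {v : Em m} (hv : v ≠ 0)
    (h : κ < ‖P v 0‖ ^ 2 / ‖v‖ ^ 2) : gluedPot P κ r Q =ᶠ[nhds v] fun v => Q (P v) := by
  filter_upwards [continuousAt_const.eventually_lt (continuousAt_gluedPot_ratio (P := P) hv) h]
    with w hw
  rw [gluedPot, coneCutoff_eq_one hκ hw.le]
  ring

end gluedPot

lemma dAlembert_clm_profile {E : Type*} [NormedAddCommGroup E] [NormedSpace ℝ E]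
    (T : (Fin 4 → ℂ) →L[ℝ] E) (μ : Fin 4 → ℂ) {f : Fin 4 → ℝ → ℂ}
    (hf : ∀ j, ContDiff ℝ (⊤ : ℕ∞) (f j)) {y : Sp 3} (hy : 0 < y 0) :
    dAlembert (fun y => T fun j => profile (μ j) (f j) y) y =
      T fun j => profile (μ j - 2) (boxOp (μ j) (f j)) y := by
  have hpd : ∀ (V : Sp 3 → Fin 4 → ℂ) (y : Sp 3) (α : Fin 4),
      (∀ j, DifferentiableAt ℝ (fun y => V y j) y) →
      pd α (fun y => T (V y)) y = T fun j => pd α (fun y => V y j) y := by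
    intro V y α hV
    have h1 := T.hasFDerivAt.comp y (hasFDerivAt_pi.2 fun j => (hV j).hasFDerivAt)
    have h2 : HasFDerivAt (fun y => T (V y)) _ y := h1
    rw [pd, h2.fderiv]
    rfl
  have hd : ∀ j (y : Sp 3), 0 < y 0 → DifferentiableAt ℝ (profile (μ j) (f j)) y :=
    fun j y hy => (contDiffAt_profile _ (hf j) hy).differentiableAt (by simp)
  have hd2 : ∀ j α (y : Sp 3), 0 < y 0 → DifferentiableAt ℝ (pd α (profile (μ j) (f j))) y := by
    intro j α y hy
    have h1 : ContDiffAt ℝ 1 (fderiv ℝ (profile (μ j) (f j))) y :=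
      (contDiffAt_profile (μ j) (hf j) hy).fderiv_right (by norm_cast)
    exact (h1.differentiableAt (by simp)).clm_apply (differentiableAt_const _)
  have h2 : ∀ α, pd α (pd α fun y => T fun j => profile (μ j) (f j) y) y =
      T fun j => pd α (pd α (profile (μ j) (f j))) y := by
    intro α
    rw [pd_congr hy (fun y hy => hpd (fun y j => profile (μ j) (f j) y) y α fun j => hd j y hy)]
    exact hpd (fun y j => pd α (profile (μ j) (f j)) y) y α fun j => hd2 j α y hy
  simp only [dAlembert, h2]
  rw [← map_neg, ← map_sum, ← map_add]
  congr 1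
  ext j
  rw [← dAlembert_profile _ (hf j) hy]
  simp [dAlembert]

lemma boxOp_const (μ c : ℂ) (s : ℝ) : boxOp μ (fun _ => c) s = -(μ * (μ - 1)) * c := by
  have h : deriv (fun _ : ℝ => c) = fun _ => 0 := by ext; simp
  simp [boxOp, h]

lemma boxOp_ofReal (a s : ℝ) : boxOp (-a : ℂ) (fun s => (s : ℂ)) s =
    ((6 - (4 * a + 6 + a * (a + 1)) * s : ℝ) : ℂ) := by
  have h : deriv (fun s : ℝ => (s : ℂ)) = fun _ => 1 := by
    ext s
    exact Complex.ofRealCLM.hasDerivAt.deriv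
  simp only [boxOp, h, deriv_const]
  push_cast
  ring

lemma contDiff_boxOp (μ : ℂ) {f : ℝ → ℂ} (hf : ContDiff ℝ (⊤ : ℕ∞) f) :
    ContDiff ℝ (⊤ : ℕ∞) (boxOp μ f) := by
  have h0 := contDiff_ofReal
  have h1 := contDiff_deriv hf
  have h2 := contDiff_deriv h1
  unfold boxOp
  exact ((contDiff_const.mul hf).add (((contDiff_const.mul h0).add contDiff_const).mul h1)).add
    (((contDiff_const.mul h0).mul (contDiff_const.sub h0)).mul h2)

lemma simVar_smul {l : ℝ} (hl : l ≠ 0) (y : Sp 3) : simVar (l • y) = simVar y := by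
  have : ∑ i : Fin 3, ((l • y) i.succ) ^ 2 = l ^ 2 * ∑ i : Fin 3, (y i.succ) ^ 2 := by
    rw [Finset.mul_sum]
    exact Finset.sum_congr rfl fun i _ => by simp [mul_pow]
  rw [simVar, simVar, this, Pi.smul_apply, smul_eq_mul, mul_pow,
    mul_div_mul_left _ _ (pow_ne_zero 2 hl)]

lemma simVar_mem_Icc {y : Sp 3} (hy : y ∈ Cone 3) : simVar y ∈ Set.Icc (0 : ℝ) 1 :=
  ⟨div_nonneg (Finset.sum_nonneg fun _ _ => sq_nonneg _) (sq_nonneg _),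
    div_le_one_of_le₀ hy.2 (sq_nonneg _)⟩

/-- Four self-similar profiles satisfying the three energy-type identities on `[0, 1]` give a
discretely self-similar solution for a suitable potential. -/
theorem exists_solution_of_profiles {p a ω : ℝ} (hp : 1 < p) (ha : a = 2 / (p - 1)) (hω : 0 < ω)
    {m : ℕ} (hm : 8 ≤ m) {φ : ℝ → ℝ} {g h : ℝ → ℂ} (hφ : ContDiff ℝ (⊤ : ℕ∞) φ)
    (hg : ContDiff ℝ (⊤ : ℕ∞) g) (hh : ContDiff ℝ (⊤ : ℕ∞) h) (hφpos : ∀ z, 0 < φ z)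
    (h0 : ∀ z ∈ Set.Icc (0 : ℝ) 1, (boxOp (-a + ω * Complex.I) (fun _ => 1) z).re +
      z * (boxOp (-a) (fun s => (s : ℂ)) z).re +
      (star (g z) * boxOp (-a + ω * Complex.I) g z).re +
      (star (h z) * boxOp (-a) h z).re = (p + 1) * φ z)
    (h1 : ∀ z ∈ Set.Icc (0 : ℝ) 1, (boxOp (-a + ω * Complex.I) (fun _ => 1) z).im +
      (star (g z) * boxOp (-a + ω * Complex.I) g z).im = 0)
    (h2 : ∀ z ∈ Set.Icc (0 : ℝ) 1, (boxOp (-a) (fun s => (s : ℂ)) z).re +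
      (star (deriv g z) * boxOp (-a + ω * Complex.I) g z).re +
      (star (deriv h z) * boxOp (-a) h z).re = deriv φ z) :
    ∃ F : Em m → ℝ, ContDiffOn ℝ (⊤ : ℕ∞) F {0}ᶜ ∧ (∀ v : Em m, v ≠ 0 → 0 < F v) ∧
      (∀ l : ℝ, 0 < l → ∀ v : Em m, F (l • v) = l ^ (p + 1) * F v) ∧
      ∃ S : ℝ, 0 < S ∧ ∃ (u : Sp 3 → Em m) (Ω : Set (Sp 3)),
        IsOpen Ω ∧ Cone 3 ⊆ Ω ∧ ContDiffOn ℝ (⊤ : ℕ∞) u Ω ∧ (∀ y ∈ Cone 3, u y ≠ 0) ∧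
        (∀ y ∈ Cone 3, dAlembert u y = gradient F (u y)) ∧
        (∀ y ∈ Cone 3, u (Real.exp S • y) = Real.exp (-(2 / (p - 1)) * S) • u y) := by
  obtain ⟨T, P, hPT, hTP⟩ := exists_isometric_coordinates hm
  set μ : ℂ := -a + ω * Complex.I with hμ
  have hμre : μ.re = -a := by simp [hμ]
  obtain ⟨M, hM⟩ := isCompact_Icc.exists_bound_of_continuousOn (s := Set.Icc (0 : ℝ) 1)
    (f := fun z : ℝ => 1 + z ^ 2 + ‖g z‖ ^ 2 + ‖h z‖ ^ 2)
    (((continuous_const.add (continuous_id.pow 2)).add (hg.continuous.norm.pow 2)).add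
      (hh.continuous.norm.pow 2)).continuousOn
  have hM' : ∀ z ∈ Set.Icc (0 : ℝ) 1, 1 + z ^ 2 + ‖g z‖ ^ 2 + ‖h z‖ ^ 2 < |M| + 1 := fun z hz =>
    lt_of_le_of_lt ((le_abs_self _).trans ((hM z hz).trans (le_abs_self M))) (lt_add_one _)
  set κ : ℝ := (|M| + 1)⁻¹ with hκdef
  have hκ : 0 < κ := by positivity
  have hφc : ContDiff ℝ (⊤ : ℕ∞) (fun z => (φ z : ℂ)) := contDiff_ofReal.comp hφ
  have hφc0 : ∀ z, (φ z : ℂ) ≠ 0 := fun z => by exact_mod_cast (hφpos z).ne'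
  have hquot : ∀ {f : ℝ → ℂ}, ContDiff ℝ (⊤ : ℕ∞) f →
      ContDiff ℝ (⊤ : ℕ∞) (fun z => f z * (φ z : ℂ)⁻¹) := fun hf => hf.mul (hφc.inv hφc0)
  set k : ℝ → ℂ := fun z => boxOp μ g z * (φ z : ℂ)⁻¹ with hk
  set l : ℝ → ℂ := fun z => boxOp (-a) h z * (φ z : ℂ)⁻¹ with hl
  have hkd : ContDiff ℝ (⊤ : ℕ∞) k := hquot (contDiff_boxOp μ hg)
  have hld : ContDiff ℝ (⊤ : ℕ∞) l := hquot (contDiff_boxOp _ hh)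
  set Q := conePot (p + 1) φ k g l h with hQ
  have hQd : ∀ c : Fin 4 → ℂ, c 0 ≠ 0 → ContDiffAt ℝ (⊤ : ℕ∞) Q c :=
    fun c hc => contDiffAt_conePot (p + 1) hφ hkd hg hld hh hc
  set fs : Fin 4 → ℝ → ℂ := ![fun _ => 1, fun s => (s : ℂ), g, h] with hfs
  set μs : Fin 4 → ℂ := ![μ, -a, μ, -a] with hμs
  have hfsd : ∀ j, ContDiff ℝ (⊤ : ℕ∞) (fs j) := by
    intro j
    fin_cases j
    exacts [contDiff_const, contDiff_ofReal, hg, hh]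
  set u : Sp 3 → Em m := fun y => T fun j => profile (μs j) (fs j) y with hu
  have hnorm : ∀ {t : ℝ}, 0 < t → ‖cpw μ t‖ = t ^ (-a) := fun ht => by rw [norm_cpw _ ht, hμre]
  have hcpwa : ∀ {t : ℝ}, 0 < t → cpw (-a) t = ‖cpw μ t‖ := fun ht => by
    rw [hnorm ht, ← cpw_ofReal _ ht, Complex.ofReal_neg]
  have hPu : ∀ y : Sp 3, 0 < y 0 → P (u y) = ![cpw μ (y 0), ‖cpw μ (y 0)‖ * simVar y,
      cpw μ (y 0) * g (simVar y), ‖cpw μ (y 0)‖ * h (simVar y)] := by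
    intro y hy
    rw [hPT]
    ext j
    fin_cases j <;> simp [profile, hμs, hfs, hcpwa hy]
  have hcpw0 : ∀ t, cpw μ t ≠ 0 := fun t => Complex.exp_ne_zero _
  have hu0 : ∀ y : Sp 3, 0 < y 0 → u y ≠ 0 := by
    intro y hy h
    have := hPu y hy
    rw [h, map_zero] at this
    exact hcpw0 (y 0) (congrFun this 0).symm
  have hTnorm : ∀ c, ‖T c‖ ^ 2 = ∑ j, ‖P (T c) j‖ ^ 2 := by
    intro c
    rw [← real_inner_self_eq_norm_sq, hTP, hPT]
    refine Finset.sum_congr rfl fun j _ => ?_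
    rw [Complex.sq_norm, Complex.normSq_apply]
    simp
  have hratio : ∀ y ∈ Cone 3, κ < ‖P (u y) 0‖ ^ 2 / ‖u y‖ ^ 2 := by
    intro y hy
    have h3 : ‖u y‖ ^ 2 = ‖cpw μ (y 0)‖ ^ 2 *
        (1 + simVar y ^ 2 + ‖g (simVar y)‖ ^ 2 + ‖h (simVar y)‖ ^ 2) := by
      rw [show ‖u y‖ ^ 2 = ∑ j, ‖P (u y) j‖ ^ 2 from hTnorm _, hPu y hy.1, Fin.sum_univ_four]
      simp [mul_pow]
      ring
    have h4 : 0 < ‖cpw μ (y 0)‖ ^ 2 := by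
      have := norm_pos_iff.2 (hcpw0 (y 0))
      positivity
    rw [h3, hPu y hy.1, Matrix.cons_val_zero, ← div_div, div_self h4.ne', hκdef, one_div]
    exact inv_strictAnti₀ (by positivity) (hM' _ (simVar_mem_Icc hy))
  refine ⟨gluedPot P κ (p + 1) Q,
    fun v hv => (contDiffAt_gluedPot hκ hQd hv).contDiffWithinAt,
    fun v hv => gluedPot_pos hκ (fun c hc => conePot_pos hφpos _ _ _ _ hc) hv,
    fun s hs v => gluedPot_smul (fun s hs c => conePot_smul _ _ _ _ _ _ hs c) hs v,
    2 * π / ω, by positivity, u, {y | 0 < y 0},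
    isOpen_lt continuous_const (continuous_apply 0), fun y hy => hy.1, ?_,
    fun y hy => hu0 y hy.1, ?_, ?_⟩
  · intro y hy
    have hprof : ContDiffAt ℝ (⊤ : ℕ∞) (fun y j => profile (μs j) (fs j) y) y :=
      contDiffAt_pi.2 fun j => contDiffAt_profile _ (hfsd j) hy
    exact (T.contDiff.contDiffAt.comp y hprof).contDiffWithinAt
  · intro y hy
    have ht := hy.1
    have hz := simVar_mem_Icc hy
    symm
    apply HasGradientAt.gradient
    have hPu0 : P (u y) 0 ≠ 0 := by
      rw [hPu y ht]
      exact hcpw0 _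
    have hQ' : HasFDerivAt Q (fderiv ℝ Q (P (u y))) (P (u y)) :=
      ((hQd _ hPu0).differentiableAt (by simp)).hasFDerivAt
    have hF := (hQ'.comp (u y) P.hasFDerivAt).congr_of_eventuallyEq
      (gluedPot_eventuallyEq (r := p + 1) (Q := Q) hκ (hu0 y ht) (hratio y hy))
    refine (hasGradientAt_iff_hasFDerivAt).2 (hF.congr_fderiv ?_)
    ext v
    have hline := hQ'.hasLineDerivAt (P v)
    rw [hPu y ht] at hline
    have hφ0 := hφc0 (simVar y)
    have h5 := hline.unique (hasLineDerivAt_conePot (hφ.differentiable (by simp))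
      (hkd.differentiable (by simp)) (hg.differentiable (by simp)) (hld.differentiable (by simp))
      (hh.differentiable (by simp)) (z := simVar y)
      (Z₂ := boxOp μ g (simVar y)) (Z₃ := boxOp (-a) h (simVar y))
      (by rw [hk]; field_simp) (by rw [hl]; field_simp) (h0 _ hz) (h1 _ hz)
      (by rw [boxOp_ofReal, Complex.ofReal_im]) (h2 _ hz) (hcpw0 (y 0)) (P v))
    rw [← hPu y ht] at h5
    rw [ContinuousLinearMap.comp_apply, h5, hu, dAlembert_clm_profile T μs hfsd ht,
      InnerProductSpace.toDual_apply_apply, hTP, Fin.sum_univ_four]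
    have hy0 : (y 0 : ℂ) ≠ 0 := by exact_mod_cast ht.ne'
    have hpow : ‖cpw μ (y 0)‖ ^ (p + 1) = ‖cpw μ (y 0)‖ ^ 2 / (y 0) ^ 2 := by
      have hp1 : p - 1 ≠ 0 := by linarith
      rw [hnorm ht, ← Real.rpow_mul ht.le, ← Real.rpow_natCast (y 0 ^ (-a)), ← Real.rpow_mul ht.le,
        ← Real.rpow_natCast (y 0), ← Real.rpow_sub ht]
      congr 1
      rw [ha]
      field_simp
      push_cast
      ring
    have he : star (cpw μ (y 0)) * cpw μ (y 0) = (‖cpw μ (y 0)‖ : ℂ) ^ 2 :=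
      Complex.conj_mul' _
    rw [hpow, ← Complex.re_ofReal_mul, ← Complex.add_re, ← Complex.add_re, ← Complex.add_re]
    congr 1
    have he0 := hcpw0 (y 0)
    have hn0 : (‖cpw μ (y 0)‖ : ℂ) ≠ 0 := by exact_mod_cast norm_ne_zero_iff.2 he0
    simp only [hμs, hfs, profile, Matrix.cons_val_zero, Matrix.cons_val_one, Matrix.cons_val,
      cpw_sub_two _ ht, hcpwa ht]
    simp only [star_mul', star_div₀, star_pow, Complex.star_def, Complex.conj_ofReal] at he ⊢
    push_cast
    rw [← he]
    generalize cpw μ (y 0) = e at *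
    field_simp
    linear_combination (starRingEnd ℂ (boxOp (-a) (fun s => (s : ℂ)) (simVar y)) * P v 1 +
      starRingEnd ℂ (boxOp (-a) h (simVar y)) * P v 3) * he
  · intro y hy
    have ht := hy.1
    have he := Real.exp_pos (2 * π / ω)
    have h3 : ∀ ν : ℂ, cpw ν (rexp (2 * π / ω)) = Complex.exp (ν * (2 * π / ω : ℝ)) := by
      intro ν
      rw [cpw, Real.log_exp]
    have h4 : ∀ j, cpw (μs j) (rexp (2 * π / ω)) = (rexp (-(2 / (p - 1)) * (2 * π / ω)) : ℝ) := by
      have hA : cpw (-a) (rexp (2 * π / ω)) = (rexp (-(2 / (p - 1)) * (2 * π / ω)) : ℝ) := by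
        rw [h3, ← ha]
        push_cast
        rfl
      have hB : cpw μ (rexp (2 * π / ω)) = cpw (-a) (rexp (2 * π / ω)) := by
        have hω' : (ω : ℂ) ≠ 0 := by exact_mod_cast hω.ne'
        rw [h3, h3, hμ, add_mul, Complex.exp_add]
        have : (ω : ℂ) * Complex.I * ((2 * π / ω : ℝ) : ℂ) = 2 * π * Complex.I := by
          push_cast
          field_simp
        rw [this, Complex.exp_two_pi_mul_I, mul_one]
      intro j
      fin_cases j
      exacts [hB.trans hA, hA, hB.trans hA, hA]
    rw [hu]
    simp only
    rw [← map_smul]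
    congr 1
    ext j
    rw [Pi.smul_apply, profile, profile, simVar_smul he.ne', Pi.smul_apply, smul_eq_mul,
      cpw_mul _ he ht, h4, Complex.real_smul, mul_assoc]

lemma exists_pos_extension {φ : ℝ → ℝ} (hφ : ContDiff ℝ (⊤ : ℕ∞) φ)
    (hpos : ∀ z ∈ Set.Icc (0 : ℝ) 1, 0 < φ z) :
    ∃ χ : ℝ → ℝ, ContDiff ℝ (⊤ : ℕ∞) χ ∧ (∀ z, 0 < χ z) ∧
      ∀ z ∈ Set.Icc (0 : ℝ) 1, χ =ᶠ[nhds z] φ := by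
  have ho : IsOpen {z | 0 < φ z} := isOpen_lt continuous_const hφ.continuous
  obtain ⟨β, h1, h0, h01⟩ := exists_contMDiffMap_one_nhds_of_subset_interior
    (n := (⊤ : ℕ∞)) (modelWithCornersSelf ℝ ℝ) (s := Set.Icc (0 : ℝ) 1) (t := {z | 0 < φ z}) isClosed_Icc
    (by rw [ho.interior_eq]; exact hpos)
  have hβ : ContDiff ℝ (⊤ : ℕ∞) β := β.contMDiff.contDiff
  refine ⟨fun z => β z * φ z + (1 - β z), (hβ.mul hφ).add (contDiff_const.sub hβ), ?_, ?_⟩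
  · intro z
    by_cases hz : 0 < φ z
    · obtain ⟨h2, h3⟩ := h01 z
      rcases h2.eq_or_lt with h2 | h2
      · simp [← h2]
      · have := mul_pos h2 hz
        linarith
    · simp [h0 z hz]
  · intro z hz
    filter_upwards [h1.filter_mono (nhds_le_nhdsSet hz)] with x hx
    simp [hx]

lemma exists_sqrt_extension {φ : ℝ → ℝ} (hφ : ContDiff ℝ (⊤ : ℕ∞) φ)
    (hpos : ∀ z ∈ Set.Icc (0 : ℝ) 1, 0 < φ z) :
    ∃ A : ℝ → ℝ, ContDiff ℝ (⊤ : ℕ∞) A ∧ (∀ z, 0 < A z) ∧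
      ∀ z ∈ Set.Icc (0 : ℝ) 1, (fun s => A s ^ 2) =ᶠ[nhds z] φ := by
  obtain ⟨χ, h1, h2, h3⟩ := exists_pos_extension hφ hpos
  refine ⟨fun z => √(χ z), h1.sqrt fun z => (h2 z).ne', fun z => Real.sqrt_pos.2 (h2 z), ?_⟩
  intro z hz
  filter_upwards [h3 z hz] with x hx
  rw [Real.sq_sqrt (h2 x).le, hx]

lemma exists_contDiff_antideriv {ψ : ℝ → ℝ} (hψ : ContDiff ℝ (⊤ : ℕ∞) ψ) :
    ∃ Ψ : ℝ → ℝ, ContDiff ℝ (⊤ : ℕ∞) Ψ ∧ deriv Ψ = ψ := by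
  have hd : ∀ z, HasDerivAt (fun u => ∫ x in (0 : ℝ)..u, ψ x) (ψ z) z :=
    fun z => (hψ.continuous.integral_hasStrictDerivAt 0 z).hasDerivAt
  have hderiv : deriv (fun u => ∫ x in (0 : ℝ)..u, ψ x) = ψ := funext fun z => (hd z).deriv
  exact ⟨_, contDiff_infty_iff_deriv.2 ⟨fun z => (hd z).differentiableAt, by rw [hderiv]; exact hψ⟩, hderiv⟩

lemma exists_scale_lt {f g : ℝ → ℝ} (hf : Continuous f) (hg : Continuous g)
    (hpos : ∀ z ∈ Set.Icc (0 : ℝ) 1, 0 < f z) :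
    ∃ S₀ : ℝ, 0 < S₀ ∧ ∀ S ≥ S₀, ∀ z ∈ Set.Icc (0 : ℝ) 1, g z < S * f z := by
  have hc : ContinuousOn (fun z => g z / f z) (Set.Icc 0 1) :=
    hg.continuousOn.div hf.continuousOn fun z hz => (hpos z hz).ne'
  obtain ⟨M, hM⟩ := isCompact_Icc.exists_bound_of_continuousOn hc
  refine ⟨|M| + 1, by positivity, fun S hS z hz => ?_⟩
  rw [← div_lt_iff₀ (hpos z hz)]
  have h1 := (le_abs_self _).trans (hM z hz)
  have h2 := le_abs_self M
  linarith

/-- The kinetic density of the curve `A exp (i Ψ)`. -/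
def polarEnergy (A Ψ : ℝ → ℝ) (s : ℝ) : ℝ := deriv A s ^ 2 + A s ^ 2 * deriv Ψ s ^ 2

lemma boxOp_polar (a k : ℝ) {A Ψ : ℝ → ℝ} (hA : ContDiff ℝ (⊤ : ℕ∞) A)
    (hΨ : ContDiff ℝ (⊤ : ℕ∞) Ψ) (z : ℝ) :
    let g : ℝ → ℂ := fun s => A s * Complex.exp (Ψ s * Complex.I)
    let N : ℝ → ℝ := fun s => A s ^ 2
    let J : ℝ → ℝ := fun s => A s ^ 2 * deriv Ψ s
    (star (g z) * boxOp (-a + k * Complex.I) g z).re =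
        -(a * (a + 1) - k ^ 2) * N z + (3 - (2 * a + 3) * z) * deriv N z - 4 * k * z * J z +
          2 * z * (1 - z) * deriv (deriv N) z - 4 * z * (1 - z) * polarEnergy A Ψ z ∧
    (star (g z) * boxOp (-a + k * Complex.I) g z).im =
        k * (2 * a + 1) * N z + (6 - (4 * a + 6) * z) * J z + 2 * k * z * deriv N z +
          4 * z * (1 - z) * deriv J z ∧
    (star (deriv g z) * boxOp (-a + k * Complex.I) g z).re =
        -(a * (a + 1) - k ^ 2) * (deriv N z / 2) + (6 - (4 * a + 6) * z) * polarEnergy A Ψ z +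
          2 * z * (1 - z) * deriv (polarEnergy A Ψ) z + k * (2 * a + 1) * J z := by
  intro g N J
  have hA1 := contDiff_deriv hA
  have hΨ1 := contDiff_deriv hΨ
  have dA : ∀ s, HasDerivAt A (deriv A s) s := fun s => (hA.differentiable (by simp) s).hasDerivAt
  have dA1 : ∀ s, HasDerivAt (deriv A) (deriv (deriv A) s) s :=
    fun s => (hA1.differentiable (by simp) s).hasDerivAt
  have dΨ : ∀ s, HasDerivAt Ψ (deriv Ψ s) s := fun s => (hΨ.differentiable (by simp) s).hasDerivAt
  have dΨ1 : ∀ s, HasDerivAt (deriv Ψ) (deriv (deriv Ψ) s) s :=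
    fun s => (hΨ1.differentiable (by simp) s).hasDerivAt
  have dN : deriv N = fun s => 2 * A s * deriv A s := by
    ext s
    have h1 : HasDerivAt N _ s := (dA s).pow 2
    rw [h1.deriv]
    simp
  have dN2 : deriv (deriv N) z = 2 * deriv A z ^ 2 + 2 * A z * deriv (deriv A) z := by
    have h1 : HasDerivAt (fun s => 2 * A s * deriv A s) _ z := ((dA z).const_mul 2).mul (dA1 z)
    rw [dN, h1.deriv]
    ring
  have dJ : deriv J z = 2 * A z * deriv A z * deriv Ψ z + A z ^ 2 * deriv (deriv Ψ) z := by
    have h1 : HasDerivAt J _ z := ((dA z).pow 2).mul (dΨ1 z)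
    rw [h1.deriv]
    simp
  have dE : deriv (polarEnergy A Ψ) z = 2 * deriv A z * deriv (deriv A) z +
      2 * A z * deriv A z * deriv Ψ z ^ 2 + 2 * A z ^ 2 * deriv Ψ z * deriv (deriv Ψ) z := by
    have h1 : HasDerivAt (polarEnergy A Ψ) _ z :=
      ((dA1 z).pow 2).add (((dA z).pow 2).mul ((dΨ1 z).pow 2))
    rw [h1.deriv]
    simp
    ring
  have de : ∀ s, HasDerivAt (fun s => Complex.exp (Ψ s * Complex.I))
      (Complex.exp (Ψ s * Complex.I) * (deriv Ψ s * Complex.I)) s :=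
    fun s => ((dΨ s).ofReal_comp.mul_const Complex.I).cexp
  have dg : deriv g = fun s => (deriv A s + A s * deriv Ψ s * Complex.I) *
      Complex.exp (Ψ s * Complex.I) := by
    ext s
    have h1 : HasDerivAt g _ s := (dA s).ofReal_comp.mul (de s)
    rw [h1.deriv]
    ring
  have dg2 : deriv (deriv g) z = (deriv (deriv A) z - A z * deriv Ψ z ^ 2 +
      (2 * deriv A z * deriv Ψ z + A z * deriv (deriv Ψ) z) * Complex.I) *
      Complex.exp (Ψ z * Complex.I) := by
    have h1 : HasDerivAt (fun s => (deriv A s + A s * deriv Ψ s * Complex.I) *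
      Complex.exp (Ψ s * Complex.I)) _ z := ((dA1 z).ofReal_comp.add
        (((dA z).ofReal_comp.mul (dΨ1 z).ofReal_comp).mul_const Complex.I)).mul (de z)
    rw [dg, h1.deriv]
    simp only [Pi.add_apply, Pi.mul_apply]
    linear_combination (A z * deriv Ψ z ^ 2 * Complex.exp (Ψ z * Complex.I)) * Complex.I_sq
  have he : star (Complex.exp (Ψ z * Complex.I)) * Complex.exp (Ψ z * Complex.I) = 1 := by
    rw [Complex.star_def, Complex.conj_mul', Complex.norm_exp_ofReal_mul_I]
    simp
  obtain ⟨P, hP⟩ : ∃ P : ℝ, P = -(a * (a + 1) - k ^ 2) * A z + (6 - (4 * a + 6) * z) * deriv A z -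
      4 * k * z * (A z * deriv Ψ z) +
      4 * z * (1 - z) * (deriv (deriv A) z - A z * deriv Ψ z ^ 2) := ⟨_, rfl⟩
  obtain ⟨Q, hQ⟩ : ∃ Q : ℝ, Q = k * (2 * a + 1) * A z +
      (6 - (4 * a + 6) * z) * (A z * deriv Ψ z) + 4 * k * z * deriv A z +
      4 * z * (1 - z) * (2 * deriv A z * deriv Ψ z + A z * deriv (deriv Ψ) z) := ⟨_, rfl⟩
  have hbox : boxOp (-a + k * Complex.I) g z =
      (P + Q * Complex.I) * Complex.exp (Ψ z * Complex.I) := by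
    rw [boxOp, dg2, dg, hP, hQ]
    simp only [g]
    push_cast
    linear_combination (-(k : ℂ) ^ 2 * A z + 4 * k * z * (A z * (deriv Ψ z : ℝ))) *
      Complex.exp (Ψ z * Complex.I) * Complex.I_sq
  have h1 : star (g z) * boxOp (-a + k * Complex.I) g z = A z * (P + Q * Complex.I) := by
    have h3 : star (A z : ℂ) = A z := Complex.conj_ofReal _
    rw [hbox, star_mul', h3]
    linear_combination (A z * (P + Q * Complex.I)) * he
  have h2 : star (deriv g z) * boxOp (-a + k * Complex.I) g z =
      (deriv A z - (A z * deriv Ψ z : ℝ) * Complex.I) * (P + Q * Complex.I) := by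
    have h3 : star (deriv A z + A z * deriv Ψ z * Complex.I : ℂ) =
        deriv A z - (A z * deriv Ψ z : ℝ) * Complex.I := by
      apply Complex.ext <;> simp
    rw [hbox, dg, star_mul', h3]
    linear_combination (((deriv A z : ℝ) - (A z * deriv Ψ z : ℝ) * Complex.I) *
      (P + Q * Complex.I)) * he
  refine ⟨?_, ?_, ?_⟩
  · rw [h1, Complex.re_ofReal_mul, dN2, dN]
    have h4 : (P + Q * Complex.I).re = P := by simp
    rw [h4, hP]
    simp only [N, J, polarEnergy]
    ring
  · rw [h1, Complex.im_ofReal_mul, dJ, dN]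
    have h4 : (P + Q * Complex.I).im = Q := by simp
    rw [h4, hQ]
    simp only [N, J]
    ring
  · rw [h2, dE, dN]
    have h4 : ∀ x y : ℝ, ((x - y * Complex.I) * (P + Q * Complex.I)).re = x * P + y * Q := by
      intro x y
      simp
    rw [h4, hP, hQ]
    simp only [J, polarEnergy]
    ring

lemma exists_curves {a : ℝ} {K G X F : ℝ → ℝ} (hK : ContDiff ℝ (⊤ : ℕ∞) K)
    (hG : ContDiff ℝ (⊤ : ℕ∞) G) (hX : ContDiff ℝ (⊤ : ℕ∞) X) (hF : ContDiff ℝ (⊤ : ℕ∞) F)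
    (hKpos : ∀ z ∈ Set.Icc (0 : ℝ) 1, 0 < K z) (hFpos : ∀ z ∈ Set.Icc (0 : ℝ) 1, 0 < F z)
    (hKX : ∀ z ∈ Set.Icc (0 : ℝ) 1, G z ^ 2 < K z * X z) :
    ∃ (ω S M : ℝ) (A Ψ B χ : ℝ → ℝ), 0 < ω ∧ 0 < S ∧ ContDiff ℝ (⊤ : ℕ∞) A ∧
      ContDiff ℝ (⊤ : ℕ∞) Ψ ∧ ContDiff ℝ (⊤ : ℕ∞) B ∧ ContDiff ℝ (⊤ : ℕ∞) χ ∧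
      (∀ s, A s ^ 2 * deriv Ψ s = ω * S / 2 * G s) ∧
      ∀ z ∈ Set.Icc (0 : ℝ) 1, 0 < ω ^ 2 * S * F z - a ^ 2 * M / 2 ∧
        (fun s => A s ^ 2) =ᶠ[nhds z] (fun s => S * K s - 1) ∧
        (fun s => B s ^ 2) =ᶠ[nhds z] (fun s => M - s ^ 2 - S * K s) ∧
        (fun s => polarEnergy A Ψ s + polarEnergy B χ s) =ᶠ[nhds z]
          (fun s => ω ^ 2 * S / 4 * X s - 1) := by
  have hdet : ContDiff ℝ (⊤ : ℕ∞) (fun z => K z * X z - G z ^ 2) := (hK.mul hX).sub (hG.pow 2)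
  obtain ⟨S₁, hS₁, h1⟩ := exists_scale_lt hK.continuous (continuous_const (y := (1 : ℝ))) hKpos
  obtain ⟨S₂, hS₂, h2⟩ := exists_scale_lt hdet.continuous hX.continuous
    (fun z hz => by linarith [hKX z hz])
  obtain ⟨S, hS⟩ : ∃ S, S = S₁ + S₂ := ⟨_, rfl⟩
  have hSpos : 0 < S := by linarith
  have hSK : ∀ z ∈ Set.Icc (0 : ℝ) 1, 0 < S * K z - 1 := fun z hz => by
    linarith [h1 S (by linarith) z hz]
  obtain ⟨A, hA, hApos, hAeq⟩ :=
    exists_sqrt_extension ((contDiff_const (c := S)).mul hK |>.sub contDiff_const) hSK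
  have hSK2 : ContDiff ℝ (⊤ : ℕ∞) (fun s : ℝ => s ^ 2 + S * K s) :=
    (contDiff_id.pow 2).add (contDiff_const.mul hK)
  obtain ⟨M, hM, h3⟩ := exists_scale_lt (continuous_const (y := (1 : ℝ))) hSK2.continuous
    (fun _ _ => one_pos)
  have hMK : ∀ z ∈ Set.Icc (0 : ℝ) 1, 0 < M - z ^ 2 - S * K z := fun z hz => by
    linarith [h3 M le_rfl z hz]
  obtain ⟨B, hB, hBpos, hBeq⟩ := exists_sqrt_extension
    (((contDiff_const (c := M)).sub (contDiff_id.pow 2)).sub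
      ((contDiff_const (c := S)).mul hK)) hMK
  have hA2 : ContDiff ℝ (⊤ : ℕ∞) (fun s => S ^ 2 * G s ^ 2 / A s ^ 2) :=
    (contDiff_const.mul (hG.pow 2)).div (hA.pow 2) fun s => (pow_pos (hApos s) 2).ne'
  have hf : ContDiff ℝ (⊤ : ℕ∞) (fun s => S * X s - S ^ 2 * G s ^ 2 / A s ^ 2) :=
    (contDiff_const.mul hX).sub hA2
  have hfpos : ∀ z ∈ Set.Icc (0 : ℝ) 1, 0 < S * X z - S ^ 2 * G z ^ 2 / A z ^ 2 := by
    intro z hz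
    have h4 := (hAeq z hz).eq_of_nhds
    have h5 := h2 S (by linarith) z hz
    rw [h4, sub_pos, div_lt_iff₀ (hSK z hz)]
    nlinarith
  have hkin : ContDiff ℝ (⊤ : ℕ∞) (fun s => 4 + 4 * deriv A s ^ 2 + 4 * deriv B s ^ 2) :=
    (contDiff_const.add (contDiff_const.mul ((contDiff_deriv hA).pow 2))).add
      (contDiff_const.mul ((contDiff_deriv hB).pow 2))
  obtain ⟨T₁, hT₁, h4⟩ := exists_scale_lt hf.continuous hkin.continuous hfpos
  obtain ⟨T₂, hT₂, h5⟩ := exists_scale_lt (hF.continuous.const_mul S)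
    (continuous_const (y := a ^ 2 * M / 2)) (fun z hz => mul_pos hSpos (hFpos z hz))
  obtain ⟨ω, hω, hωT⟩ : ∃ ω : ℝ, 0 < ω ∧ ω ^ 2 = T₁ + T₂ :=
    ⟨√(T₁ + T₂), Real.sqrt_pos.2 (by linarith), Real.sq_sqrt (by linarith)⟩
  have hD : ContDiff ℝ (⊤ : ℕ∞) (fun s => ω ^ 2 * (S * X s - S ^ 2 * G s ^ 2 / A s ^ 2) -
      (4 + 4 * deriv A s ^ 2 + 4 * deriv B s ^ 2)) := (contDiff_const.mul hf).sub hkin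
  obtain ⟨D, hD, -, hDeq⟩ := exists_sqrt_extension hD
    (fun z hz => by linarith [h4 (ω ^ 2) (by linarith) z hz])
  have hψ : ContDiff ℝ (⊤ : ℕ∞) (fun s => ω * S / 2 * G s / A s ^ 2) :=
    (contDiff_const.mul hG).div (hA.pow 2) fun s => (pow_pos (hApos s) 2).ne'
  obtain ⟨Ψ, hΨ, hΨd⟩ := exists_contDiff_antideriv hψ
  have hχ : ContDiff ℝ (⊤ : ℕ∞) (fun s => D s / (2 * B s)) :=
    hD.div (contDiff_const.mul hB) fun s => (mul_pos two_pos (hBpos s)).ne'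
  obtain ⟨χ, hχ, hχd⟩ := exists_contDiff_antideriv hχ
  refine ⟨ω, S, M, A, Ψ, B, χ, hω, hSpos, hA, hΨ, hB, hχ, fun s => ?_, fun z hz =>
    ⟨?_, hAeq z hz, hBeq z hz, ?_⟩⟩
  · rw [hΨd]
    have := (hApos s).ne'
    field_simp
  · have := h5 (ω ^ 2) (by linarith) z hz
    linarith
  · filter_upwards [hDeq z hz] with s hs
    have h6 := (hApos s).ne'
    have h7 := (hBpos s).ne'
    rw [polarEnergy, polarEnergy, hΨd, hχd]
    have h8 : B s ^ 2 * (D s / (2 * B s)) ^ 2 = D s ^ 2 / 4 := by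
      field_simp
      ring
    rw [h8, hs]
    field_simp
    ring

theorem exists_solution_of_densities {p a q : ℝ} (hp : 1 < p) (ha : a = 2 / (p - 1))
    (hq : q = (p - 1) / 2) {m : ℕ} (hm : 8 ≤ m) {K G X F : ℝ → ℝ}
    (hK : ContDiff ℝ (⊤ : ℕ∞) K) (hG : ContDiff ℝ (⊤ : ℕ∞) G) (hX : ContDiff ℝ (⊤ : ℕ∞) X)
    (hF : ContDiff ℝ (⊤ : ℕ∞) F)
    (hKpos : ∀ z ∈ Set.Icc (0 : ℝ) 1, 0 < K z) (hFpos : ∀ z ∈ Set.Icc (0 : ℝ) 1, 0 < F z)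
    (hKX : ∀ z ∈ Set.Icc (0 : ℝ) 1, G z ^ 2 < K z * X z)
    (e0 : ∀ z, (2 * q + 2) * F z = K z - 2 * z * G z - z * (1 - z) * X z)
    (e1 : ∀ z, (2 * a + 1) * K z + (3 - (2 * a + 3) * z) * G z + 2 * z * deriv K z +
      2 * z * (1 - z) * deriv G z = 0)
    (e2 : ∀ z, 2 * deriv F z = deriv K z + (2 * a + 1) * G z + (3 - (2 * a + 3) * z) * X z +
      z * (1 - z) * deriv X z) :
    ∃ F : Em m → ℝ, ContDiffOn ℝ (⊤ : ℕ∞) F {0}ᶜ ∧ (∀ v : Em m, v ≠ 0 → 0 < F v) ∧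
      (∀ l : ℝ, 0 < l → ∀ v : Em m, F (l • v) = l ^ (p + 1) * F v) ∧
      ∃ S : ℝ, 0 < S ∧ ∃ (u : Sp 3 → Em m) (Ω : Set (Sp 3)),
        IsOpen Ω ∧ Cone 3 ⊆ Ω ∧ ContDiffOn ℝ (⊤ : ℕ∞) u Ω ∧ (∀ y ∈ Cone 3, u y ≠ 0) ∧
        (∀ y ∈ Cone 3, dAlembert u y = gradient F (u y)) ∧
        (∀ y ∈ Cone 3, u (Real.exp S • y) = Real.exp (-(2 / (p - 1)) * S) • u y) := by
  obtain ⟨ω, S, M, A, Ψ, B, χ, hω, hS, hA, hΨ, hB, hχ, hJ, hz⟩ :=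
    exists_curves (a := a) hK hG hX hF hKpos hFpos hKX
  have haq : a * q = 1 := by
    have : p - 1 ≠ 0 := by linarith
    rw [ha, hq]
    field_simp
  have hpq : p = 2 * q + 1 := by linarith
  obtain ⟨φ, hφ, hφpos, hφeq⟩ := exists_pos_extension
    (((contDiff_const (c := ω ^ 2 * S)).mul hF).sub (contDiff_const (c := a ^ 2 * M / 2)))
    (fun z h => (hz z h).1)
  have hg : ∀ {A Ψ : ℝ → ℝ}, ContDiff ℝ (⊤ : ℕ∞) A → ContDiff ℝ (⊤ : ℕ∞) Ψ →
      ContDiff ℝ (⊤ : ℕ∞) (fun s => (A s : ℂ) * Complex.exp (Ψ s * Complex.I)) := fun hA hΨ =>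
    (contDiff_ofReal.comp hA).mul ((contDiff_ofReal.comp hΨ).mul contDiff_const).cexp
  have dK : ∀ s, HasDerivAt K (deriv K s) s := fun s => (hK.differentiable (by simp) s).hasDerivAt
  have dX : ∀ s, HasDerivAt X (deriv X s) s := fun s => (hX.differentiable (by simp) s).hasDerivAt
  have dF : ∀ s, HasDerivAt F (deriv F s) s := fun s => (hF.differentiable (by simp) s).hasDerivAt
  have dG : ∀ s, HasDerivAt G (deriv G s) s := fun s => (hG.differentiable (by simp) s).hasDerivAt
  have dK1 : ∀ s, HasDerivAt (deriv K) (deriv (deriv K) s) s :=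
    fun s => ((contDiff_deriv hK).differentiable (by simp) s).hasDerivAt
  have hJA : (fun s => A s ^ 2 * deriv Ψ s) = fun s => ω * S / 2 * G s := funext hJ
  have dJA : ∀ z, deriv (fun s => A s ^ 2 * deriv Ψ s) z = ω * S / 2 * deriv G z := fun z => by
    rw [hJA, ((dG z).const_mul _).deriv]
  have dSK : deriv (fun s => S * K s - 1) = fun s => S * deriv K s := by
    ext s
    rw [(((dK s).const_mul S).sub_const 1).deriv]
  have dB : deriv (fun s => M - s ^ 2 - S * K s) = fun s => -(2 * s) - S * deriv K s := by
    ext s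
    have h1 : HasDerivAt (fun s => M - s ^ 2 - S * K s) _ s :=
      ((hasDerivAt_pow 2 s).const_sub M).sub ((dK s).const_mul S)
    rw [h1.deriv]
    simp
  have dB2 : ∀ z, deriv (deriv (fun s => M - s ^ 2 - S * K s)) z =
      -2 - S * deriv (deriv K) z := fun z => by
    have h1 : HasDerivAt (fun s => -(2 * s) - S * deriv K s) _ z :=
      ((hasDerivAt_id z).const_mul 2).neg.sub ((dK1 z).const_mul S)
    rw [dB, h1.deriv]
    simp
  have hE : ∀ {A Ψ : ℝ → ℝ}, ContDiff ℝ (⊤ : ℕ∞) A → ContDiff ℝ (⊤ : ℕ∞) Ψ →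
      ContDiff ℝ (⊤ : ℕ∞) (polarEnergy A Ψ) := fun hA hΨ =>
    ((contDiff_deriv hA).pow 2).add ((hA.pow 2).mul ((contDiff_deriv hΨ).pow 2))
  have hre : ∀ x y : ℝ, ((x : ℂ) + y * Complex.I).re = x := by simp
  have him : ∀ x y : ℝ, ((x : ℂ) + y * Complex.I).im = y := by simp
  refine exists_solution_of_profiles hp ha hω hm hφ (hg hA hΨ) (hg hB hχ) hφpos
    (fun z h => ?_) (fun z h => ?_) (fun z h => ?_)
  all_goals
    obtain ⟨-, hNA, hNB, hEE⟩ := hz z h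
    obtain ⟨a1, a2, a3⟩ := boxOp_polar a ω hA hΨ z
    obtain ⟨b1, b2, b3⟩ := boxOp_polar a 0 hB hχ z
    have hzero : (-(a : ℂ) + ((0 : ℝ) : ℂ) * Complex.I) = -a := by simp
    rw [hzero] at b1 b2 b3
    have nA := hNA.eq_of_nhds
    have nB := hNB.eq_of_nhds
    have nE := hEE.eq_of_nhds
    have nφ := (hφeq z h).eq_of_nhds
    have nA1 := hNA.deriv_eq
    have nB1 := hNB.deriv_eq
    have nE1 := hEE.deriv_eq
    have nφ1 := (hφeq z h).deriv_eq
    have nA2 := hNA.deriv.deriv_eq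
    have nB2 := hNB.deriv.deriv_eq
    rw [dSK] at nA1 nA2
    rw [dB2] at nB2
    rw [dB] at nB1
    have k1 : HasDerivAt (fun s => polarEnergy A Ψ s + polarEnergy B χ s)
        (deriv (polarEnergy A Ψ) z + deriv (polarEnergy B χ) z) z :=
      ((hE hA hΨ).differentiable (by simp) z).hasDerivAt.add
        ((hE hB hχ).differentiable (by simp) z).hasDerivAt
    rw [k1.deriv, (((dX z).const_mul _).sub_const 1).deriv] at nE1
    rw [(((dF z).const_mul _).sub_const _).deriv] at nφ1
    rw [((dK1 z).const_mul S).deriv] at nA2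
    have jA := hJ z
    have jA1 := dJA z
    have f0 := e0 z
    have f1 := e1 z
    have f2 := e2 z
    have c0 : boxOp (-a + ω * Complex.I) (fun _ => 1) z =
        ((-(a * (a + 1) - ω ^ 2) : ℝ) : ℂ) + ((ω * (2 * a + 1) : ℝ) : ℂ) * Complex.I := by
      rw [boxOp_const]
      push_cast
      linear_combination (-(ω : ℂ) ^ 2) * Complex.I_sq
    simp only at nA nB nE nφ nA1 nB1 a1 a2 a3 b1 b2 b3
  · rw [a1, b1, c0, boxOp_ofReal, Complex.ofReal_re, hre]
    linear_combination (-(a * (a + 1) - ω ^ 2)) * nA + (3 - (2 * a + 3) * z) * (nA1 + nB1) -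
      4 * ω * z * jA + 2 * z * (1 - z) * (nA2 + nB2) - 4 * z * (1 - z) * nE -
      a * (a + 1) * nB - (p + 1) * nφ - ω ^ 2 * S * f0 -
      (ω ^ 2 * S * F z - a ^ 2 * M / 2) * hpq + a * M * haq
  · rw [a2, c0, him]
    linear_combination ω * (2 * a + 1) * nA + (6 - (4 * a + 6) * z) * jA + 2 * ω * z * nA1 +
      4 * z * (1 - z) * jA1 + ω * S * f1
  · rw [a3, b3, boxOp_ofReal, Complex.ofReal_re]
    linear_combination (-(a * (a + 1) - ω ^ 2) / 2) * nA1 - a * (a + 1) / 2 * nB1 +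
      (6 - (4 * a + 6) * z) * nE + 2 * z * (1 - z) * nE1 + ω * (2 * a + 1) * jA - nφ1 -
      ω ^ 2 * S / 2 * f2

/-- Coefficients of hypergeometric type, `y (n + 1) = y n (2n+3+2a)(n+1+a) / ((n+2)(2n+5))`. -/
def hypCoeff (a : ℝ) : ℕ → ℝ
  | 0 => 1
  | n + 1 => hypCoeff a n * ((2 * n + 3 + 2 * a) * (n + 1 + a)) / ((n + 2) * (2 * n + 5))

/-- The truncated series `∑ y (n + 1) z ^ n` over `n < N`. -/
def hypSum (a : ℝ) (N : ℕ) (z : ℝ) : ℝ := ∑ n ∈ Finset.range N, hypCoeff a (n + 1) * z ^ n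

lemma hypCoeff_succ_mul (a : ℝ) (n : ℕ) :
    (n + 2) * (2 * n + 5) * hypCoeff a (n + 1) =
      (2 * n + 3 + 2 * a) * (n + 1 + a) * hypCoeff a n := by
  rw [hypCoeff]
  field_simp

lemma hypCoeff_pos {a : ℝ} (ha : 0 < a) : ∀ n, 0 < hypCoeff a n
  | 0 => one_pos
  | n + 1 => by
    have := hypCoeff_pos ha n
    rw [hypCoeff]
    positivity

lemma hypSum_succ (a : ℝ) (N : ℕ) :
    hypSum a (N + 1) = fun z => hypSum a N z + hypCoeff a (N + 1) * z ^ N :=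
  funext fun _ => Finset.sum_range_succ _ _

lemma contDiff_hypSum (a : ℝ) (N : ℕ) : ContDiff ℝ (⊤ : ℕ∞) (hypSum a N) :=
  ContDiff.sum fun _ _ => contDiff_const.mul (contDiff_id.pow _)

lemma hypSum_zero (a : ℝ) : hypSum a 0 = fun _ => 0 := by
  ext
  simp [hypSum]

lemma deriv_hypSum_succ (a : ℝ) (N : ℕ) :
    deriv (hypSum a (N + 1)) =
      fun z => deriv (hypSum a N) z + hypCoeff a (N + 1) * (N * z ^ (N - 1)) := by
  ext z
  have h1 := (((contDiff_hypSum a N).differentiable (by simp) z).hasDerivAt).add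
    ((hasDerivAt_pow N z).const_mul (hypCoeff a (N + 1)))
  rw [hypSum_succ]
  exact h1.deriv

lemma mul_natCast_mul_pow_pred (N : ℕ) (z : ℝ) : z * (N * z ^ (N - 1)) = N * z ^ N := by
  cases N with
  | zero => simp
  | succ n =>
    rw [Nat.add_sub_cancel]
    ring

lemma mul_deriv_hypSum_succ (a : ℝ) (N : ℕ) (z : ℝ) :
    z * deriv (hypSum a (N + 1)) z =
      z * deriv (hypSum a N) z + N * hypCoeff a (N + 1) * z ^ N := by
  rw [deriv_hypSum_succ]
  linear_combination hypCoeff a (N + 1) * mul_natCast_mul_pow_pred N z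

lemma hypSum_one (a z : ℝ) : hypSum a 1 z = hypCoeff a 1 := by
  simp [hypSum]

lemma mul_deriv_hypSum_one (a z : ℝ) : z * deriv (hypSum a 1) z = 0 := by
  simpa [hypSum_zero] using mul_deriv_hypSum_succ a 0 z

lemma sq_mul_deriv_deriv_hypSum_succ (a : ℝ) (N : ℕ) (z : ℝ) :
    z ^ 2 * deriv (deriv (hypSum a (N + 1))) z =
      z ^ 2 * deriv (deriv (hypSum a N)) z + N * (N - 1) * hypCoeff a (N + 1) * z ^ N := by
  have h1 := (((contDiff_deriv (contDiff_hypSum a N)).differentiable (by simp) z).hasDerivAt).add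
    (((hasDerivAt_pow (N - 1) z).const_mul (N : ℝ)).const_mul (hypCoeff a (N + 1)))
  have h2 : deriv (fun z => deriv (hypSum a N) z + hypCoeff a (N + 1) * (N * z ^ (N - 1))) z = _ :=
    h1.deriv
  rw [deriv_hypSum_succ, h2]
  have h3 : z ^ 2 * (N * (((N - 1 : ℕ) : ℝ) * z ^ (N - 1 - 1))) = N * (N - 1) * z ^ N := by
    rcases N with _ | _ | n
    · simp
    · simp
    · simp
      ring
  linear_combination hypCoeff a (N + 1) * h3

/-- The hypergeometric differential equation, with the truncation error. -/
lemma hypSum_ode (a : ℝ) (N : ℕ) (z : ℝ) :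
    2 * z ^ 2 * (1 - z) * deriv (deriv (hypSum a N)) z +
      (11 - (11 + 4 * a) * z) * (z * deriv (hypSum a N) z) +
      (10 - (2 * a + 5) * (a + 2) * z) * hypSum a N z =
    (2 * a + 3) * (1 + a) - (2 * N + 3 + 2 * a) * (N + 1 + a) * hypCoeff a N * z ^ N := by
  induction N with
  | zero =>
    rw [hypSum_zero]
    simp [hypCoeff]
    ring
  | succ N ih =>
    have h0 := congrFun (hypSum_succ a N) z
    have h1 := mul_deriv_hypSum_succ a N z
    have h2 := sq_mul_deriv_deriv_hypSum_succ a N z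
    have h3 := hypCoeff_succ_mul a N
    push_cast
    linear_combination ih + 2 * (1 - z) * h2 + (11 - (11 + 4 * a) * z) * h1 +
      (10 - (2 * a + 5) * (a + 2) * z) * h0 + z ^ N * h3

lemma exists_mul_hypCoeff_le {a ε : ℝ} (ha : 0 < a) (ha' : a < 1 / 2) (hε : 0 < ε) :
    ∃ N : ℕ, 3 ≤ N ∧ (N + 1 + a) * hypCoeff a N ≤ ε := by
  obtain ⟨c, hc⟩ : ∃ c, c = (1 - 2 * a) / 4 := ⟨_, rfl⟩
  have hc0 : 0 < c := by linarith
  have hmono : ∀ n : ℕ, (n + 1 + a) * hypCoeff a n *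
      (1 + c * ∑ i ∈ Finset.range n, 1 / ((i : ℝ) + 1)) ≤ 1 + a := by
    intro n
    induction n with
    | zero => simp [hypCoeff]
    | succ n ih =>
      refine le_trans ?_ ih
      have hy := hypCoeff_pos ha n
      obtain ⟨T, hT⟩ : ∃ T, T = ∑ i ∈ Finset.range n, 1 / ((i : ℝ) + 1) := ⟨_, rfl⟩
      have hT0 : 0 ≤ T := hT ▸ Finset.sum_nonneg fun i _ => by positivity
      rw [Finset.sum_range_succ, ← hT]
      have h1 : ((n + 1 : ℕ) + 1 + a) * hypCoeff a (n + 1) ≤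
          (n + 1 + a) * hypCoeff a n * (1 - c * (1 / (n + 1))) := by
        have h2 := hypCoeff_succ_mul a n
        have h3 : hypCoeff a (n + 1) = (2 * n + 3 + 2 * a) * (n + 1 + a) * hypCoeff a n /
            ((n + 2) * (2 * n + 5)) := by
          rw [← h2]
          field_simp
        have h4 : (n + 2 + a) * (2 * n + 3 + 2 * a) / ((n + 2) * (2 * n + 5)) ≤
            1 - c * (1 / (n + 1)) := by
          rw [div_le_iff₀ (by positivity), ← sub_nonneg]
          have h5 : (1 - c * (1 / (n + 1))) * ((n + 2) * (2 * n + 5)) -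
              (n + 2 + a) * (2 * n + 3 + 2 * a) =
              c * (4 * (2 * n + 4 + a) * (n + 1) - (n + 2) * (2 * n + 5)) / (n + 1) := by
            rw [hc]
            field_simp
            ring
          rw [h5]
          have hn : (0 : ℝ) ≤ n := n.cast_nonneg
          have : 0 ≤ 4 * (2 * n + 4 + a) * (n + 1) - ((n : ℝ) + 2) * (2 * n + 5) := by
            nlinarith [mul_nonneg hn hn, mul_nonneg hn ha.le]
          positivity
        have h6 := mul_le_mul_of_nonneg_left h4
          (by positivity : 0 ≤ ((n : ℝ) + 1 + a) * hypCoeff a n)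
        refine le_trans (le_of_eq ?_) h6
        rw [h3]
        push_cast
        field_simp
        ring
      obtain ⟨x, hx⟩ : ∃ x, x = c * (1 / ((n : ℝ) + 1)) := ⟨_, rfl⟩
      have hx0 : 0 ≤ x := by rw [hx]; positivity
      have h7 : (1 - x) * (1 + c * T + x) ≤ 1 + c * T := by
        nlinarith [mul_nonneg hx0 (mul_nonneg hc0.le hT0)]
      calc _ ≤ (n + 1 + a) * hypCoeff a n * (1 - x) * (1 + c * (T + 1 / (n + 1))) := by
            rw [hx]
            exact mul_le_mul_of_nonneg_right h1 (by positivity)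
        _ = (n + 1 + a) * hypCoeff a n * ((1 - x) * (1 + c * T + x)) := by
            rw [hx]
            ring
        _ ≤ _ := mul_le_mul_of_nonneg_left h7 (by positivity)
  obtain ⟨N, hN, hN3⟩ := ((Real.tendsto_sum_range_one_div_nat_succ_atTop.eventually_ge_atTop
    ((1 + a) / (c * ε))).and (Filter.eventually_ge_atTop 3)).exists
  refine ⟨N, hN3, ?_⟩
  have hj := hmono N
  have hy := hypCoeff_pos ha N
  rw [div_le_iff₀ (by positivity)] at hN
  obtain ⟨T, hT⟩ : ∃ T, T = ∑ i ∈ Finset.range N, 1 / ((i : ℝ) + 1) := ⟨_, rfl⟩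
  rw [← hT] at hN hj
  by_contra! h
  have h1 : 0 < T * c := by
    by_contra! h2
    nlinarith
  nlinarith [mul_lt_mul_of_pos_right h (by linarith : 0 < 1 + c * T)]

lemma hypSum_le {a : ℝ} (ha : 0 < a) (ha' : a < 1 / 2) {z : ℝ} (hz0 : 0 ≤ z) (hz1 : z ≤ 1)
    (N : ℕ) : (1 - 2 * a) * (z * hypSum a N z) ≤ 2 - (N + 2) * hypCoeff a N := by
  induction N with
  | zero => simp [hypSum_zero, hypCoeff]
  | succ N ih =>
    have hy := hypCoeff_pos ha N
    have hy1 := hypCoeff_pos ha (N + 1)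
    have hN : (0 : ℝ) ≤ N := N.cast_nonneg
    have h1 : (N + 4 - 2 * a) * hypCoeff a (N + 1) ≤ (N + 2) * hypCoeff a N := by
      rw [← mul_le_mul_iff_right₀ (by positivity : (0 : ℝ) < (N + 2) * (2 * N + 5))]
      have h2 : ((N : ℝ) + 4 - 2 * a) * ((2 * N + 3 + 2 * a) * (N + 1 + a)) ≤
          (N + 2) * (2 * N + 5) * (N + 2) := by
        have h3 : ((N : ℝ) + 2) * (2 * N + 5) * (N + 2) -
            ((N : ℝ) + 4 - 2 * a) * ((2 * N + 3 + 2 * a) * (N + 1 + a)) =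
            N * ((1 - a) * (5 - 6 * a)) + (7 * (1 - 2 * a) + 1 + 2 * a ^ 2 + 4 * a ^ 3) := by
          ring
        have h4 : 0 ≤ (N : ℝ) * ((1 - a) * (5 - 6 * a)) :=
          mul_nonneg hN (mul_nonneg (by linarith) (by linarith))
        have : 0 < a ^ 2 := by positivity
        have : 0 < a ^ 3 := by positivity
        linarith
      have h5 := mul_le_mul_of_nonneg_right h2 hy.le
      linear_combination h5 + (N + 4 - 2 * a) * hypCoeff_succ_mul a N
    have h6 : (1 - 2 * a) * (hypCoeff a (N + 1) * z ^ (N + 1)) ≤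
        (1 - 2 * a) * hypCoeff a (N + 1) :=
      mul_le_mul_of_nonneg_left (mul_le_of_le_one_right hy1.le (pow_le_one₀ hz0 hz1))
        (by linarith)
    rw [congrFun (hypSum_succ a N) z]
    push_cast
    linear_combination ih + h6 + h1

lemma le_hypSum_combination {a : ℝ} (ha : 0 < a) (ha' : a < 1 / 2) {z : ℝ} (hz0 : 0 ≤ z) {N : ℕ}
    (hN : 1 ≤ N) :
    (1 + a) * (a / 2 - 5 / 4) * z - (N + 1 / 2 + 2 * a) * hypCoeff a N * z ^ (N + 1) ≤
      -(2 * (1 + a) * z) + 5 / 2 * z * hypSum a N z + z * (z * deriv (hypSum a N) z) -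
        (3 / 2 + 2 * a) * z ^ 2 * hypSum a N z - z ^ 2 * (z * deriv (hypSum a N) z) := by
  induction N, hN using Nat.le_induction with
  | base =>
    have h2 := hypCoeff_succ_mul a 0
    rw [hypSum_one, mul_deriv_hypSum_one]
    simp [hypCoeff] at h2 ⊢
    linear_combination (z / 4) * h2
  | succ N hN ih =>
    have h0 := congrFun (hypSum_succ a N) z
    have h1 := mul_deriv_hypSum_succ a N z
    have hy := hypCoeff_pos ha N
    have h2 : (N + 1 / 2 + 2 * a) * hypCoeff a N ≤ (N + 5 / 2) * hypCoeff a (N + 1) := by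
      rw [← mul_le_mul_iff_right₀ (by positivity : (0 : ℝ) < 2 * (N + 2))]
      have h3 : 0 ≤ (1 - a) * (1 - 2 * a) * hypCoeff a N :=
        mul_nonneg (mul_nonneg (by linarith) (by linarith)) hy.le
      linear_combination h3 - hypCoeff_succ_mul a N
    have h4 := mul_le_mul_of_nonneg_right h2 (pow_nonneg hz0 (N + 1))
    rw [h0, h1]
    push_cast
    linear_combination ih + h4

lemma le_mul_deriv_hypSum_add {a : ℝ} (ha : 0 < a) {z : ℝ} (hz0 : 0 ≤ z) {N : ℕ} (hN : 3 ≤ N) :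
    5 / 2 * hypCoeff a 1 + 7 / 2 * hypCoeff a 2 * z + 9 / 2 * hypCoeff a 3 * z ^ 2 ≤
      z * deriv (hypSum a N) z + 5 / 2 * hypSum a N z := by
  induction N, hN using Nat.le_induction with
  | base =>
    have h0 := hypSum_one a z
    have h1 := mul_deriv_hypSum_one a z
    have h2 := congrFun (hypSum_succ a 1) z
    have h3 := mul_deriv_hypSum_succ a 1 z
    have h4 := congrFun (hypSum_succ a 2) z
    have h5 := mul_deriv_hypSum_succ a 2 z
    simp at h2 h3 h4 h5
    linarith
  | succ N hN ih =>
    have hy := hypCoeff_pos ha (N + 1)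
    rw [congrFun (hypSum_succ a N) z, mul_deriv_hypSum_succ a N z]
    have : 0 ≤ (N + 5 / 2) * hypCoeff a (N + 1) * z ^ N := by positivity
    linear_combination ih + this

lemma hypSum_nonneg {a : ℝ} (ha : 0 < a) {z : ℝ} (hz0 : 0 ≤ z) (N : ℕ) : 0 ≤ hypSum a N z :=
  Finset.sum_nonneg fun n _ => mul_nonneg (hypCoeff_pos ha (n + 1)).le (pow_nonneg hz0 n)

lemma quadratic_mul_le {a : ℝ} (ha : 0 < a) (ha' : a < 1 / 2) {z : ℝ} (hz0 : 0 ≤ z)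
    (hz1 : z ≤ 1) :
    6 / 5 * (1 + a) ≤ (3 / (1 + 2 * a) - (5 / 4 - a / 2) * z) *
      (5 / 2 * hypCoeff a 1 + 7 / 2 * hypCoeff a 2 * z + 9 / 2 * hypCoeff a 3 * z ^ 2) := by
  obtain ⟨b, hb⟩ : ∃ b, b = 1 - 2 * a := ⟨_, rfl⟩
  obtain rfl : a = (1 - b) / 2 := by linarith
  have hb0 : 0 < b := by linarith
  have hb1 : b < 1 := by linarith
  have hb2 : b ^ 2 ≤ b := by nlinarith
  have e1 : 5 / 2 * hypCoeff ((1 - b) / 2) 1 = (1 + (1 - b) / 2) * (1 - b / 4) := by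
    simp [hypCoeff]
    ring
  have e2 : 7 / 2 * hypCoeff ((1 - b) / 2) 2 = (1 + (1 - b) / 2) * (1 - 37 / 60 * b +
      (15 * b ^ 2 - b ^ 3) / 120) := by
    simp [hypCoeff]
    ring
  have e3 : 9 / 2 * hypCoeff ((1 - b) / 2) 3 = (1 + (1 - b) / 2) *
      ((120 - 74 * b + 15 * b ^ 2 - b ^ 3) * (56 - 15 * b + b ^ 2) / 6720) := by
    simp [hypCoeff]
    ring
  have h2 : 1 - 31 / 50 * b ≤ 1 - 37 / 60 * b + (15 * b ^ 2 - b ^ 3) / 120 := by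
    nlinarith [pow_pos hb0 2, pow_pos hb0 3]
  have h3 : 1 - 89 / 100 * b ≤
      (120 - 74 * b + 15 * b ^ 2 - b ^ 3) * (56 - 15 * b + b ^ 2) / 6720 := by
    nlinarith [pow_pos hb0 2, pow_pos hb0 3, pow_pos hb0 4, pow_pos hb0 5,
      mul_nonneg (pow_pos hb0 2).le (sub_nonneg.2 hb1.le),
      mul_nonneg (pow_pos hb0 4).le (sub_nonneg.2 hb1.le)]
  have hk : (12 - (8 - 2 * b) * z) / (8 - 4 * b) ≤
      3 / (1 + 2 * ((1 - b) / 2)) - (5 / 4 - (1 - b) / 2 / 2) * z := by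
    have : 0 < 2 - b := by linarith
    have h4 : 3 / (1 + 2 * ((1 - b) / 2)) - (5 / 4 - (1 - b) / 2 / 2) * z =
        (12 - (8 - 2 * b - b ^ 2) * z) / (8 - 4 * b) := by
      have h5 : 1 + 2 * ((1 - b) / 2) = 2 - b := by ring
      have h6 : 8 - 4 * b = 4 * (2 - b) := by ring
      rw [h5, h6]
      field_simp
      ring
    rw [h4]
    apply div_le_div_of_nonneg_right _ (by linarith)
    nlinarith [mul_nonneg hz0 (sq_nonneg b)]
  have hC : 1 - b / 4 + (1 - 31 / 50 * b) * z + (1 - 89 / 100 * b) * z ^ 2 ≤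
      1 - b / 4 + (1 - 37 / 60 * b + (15 * b ^ 2 - b ^ 3) / 120) * z +
      ((120 - 74 * b + 15 * b ^ 2 - b ^ 3) * (56 - 15 * b + b ^ 2) / 6720) * z ^ 2 := by
    gcongr
  have hC0 : 0 ≤ 1 - b / 4 + (1 - 31 / 50 * b) * z + (1 - 89 / 100 * b) * z ^ 2 := by
    have := mul_nonneg (by linarith : 0 ≤ 1 - 31 / 50 * b) hz0
    have := mul_nonneg (by linarith : 0 ≤ 1 - 89 / 100 * b) (sq_nonneg z)
    linarith
  have hd : 0 < 8 - 4 * b := by linarith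
  have hkpos : 0 ≤ (12 - (8 - 2 * b) * z) / (8 - 4 * b) := by
    apply div_nonneg _ hd.le
    nlinarith
  have hz2 : z ^ 2 ≤ z := by nlinarith
  have hz3 : z ^ 3 ≤ z ^ 2 := by nlinarith [sq_nonneg z]
  have hmain : 6 / 5 ≤ (12 - (8 - 2 * b) * z) / (8 - 4 * b) *
      (1 - b / 4 + (1 - 31 / 50 * b) * z + (1 - 89 / 100 * b) * z ^ 2) := by
    rw [div_mul_eq_mul_div, le_div_iff₀ hd]
    have h7 : 0 ≤ (1 - b) * (12 / 5 + 4 * z + 4 * z ^ 2 - 8 * z ^ 3) :=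
      mul_nonneg (by linarith) (by linarith)
    have h8 : 0 ≤ b * (21 / 5 + 3 / 50 * z - 24 / 25 * z ^ 2 - 33 / 50 * z ^ 3) :=
      mul_nonneg hb0.le (by nlinarith)
    have h9 : 0 ≤ b * (1 - b) * (2 * z * (1 / 4 + 31 / 50 * z + 89 / 100 * z ^ 2)) :=
      mul_nonneg (mul_nonneg hb0.le (by linarith)) (by positivity)
    linear_combination h7 + h8 + h9
  have h10 := hmain.trans (mul_le_mul hk hC hC0 (hkpos.trans hk))
  have h11 := mul_le_mul_of_nonneg_right h10 (by linarith : 0 ≤ 1 + (1 - b) / 2)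
  rw [e1, e2, e3]
  linear_combination h11

lemma exists_densities {a q : ℝ} (ha : 0 < a) (ha' : a < 1 / 2) (haq : a * q = 1) :
    ∃ K G X F : ℝ → ℝ, ContDiff ℝ (⊤ : ℕ∞) K ∧ ContDiff ℝ (⊤ : ℕ∞) G ∧ ContDiff ℝ (⊤ : ℕ∞) X ∧
      ContDiff ℝ (⊤ : ℕ∞) F ∧ (∀ z ∈ Set.Icc (0 : ℝ) 1, 0 < K z) ∧
      (∀ z ∈ Set.Icc (0 : ℝ) 1, 0 < F z) ∧ (∀ z ∈ Set.Icc (0 : ℝ) 1, G z ^ 2 < K z * X z) ∧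
      (∀ z, (2 * q + 2) * F z = K z - 2 * z * G z - z * (1 - z) * X z) ∧
      (∀ z, (2 * a + 1) * K z + (3 - (2 * a + 3) * z) * G z + 2 * z * deriv K z +
        2 * z * (1 - z) * deriv G z = 0) ∧
      ∀ z, 2 * deriv F z = deriv K z + (2 * a + 1) * G z + (3 - (2 * a + 3) * z) * X z +
        z * (1 - z) * deriv X z := by
  have hq : 0 < q := by
    by_contra! h
    nlinarith
  obtain ⟨N, hN, hε⟩ := exists_mul_hypCoeff_le ha ha' (by positivity : 0 < 1 / (20 * (q + 2)))
  have hy := hypCoeff_pos ha N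
  obtain ⟨y, hyN⟩ : ∃ y, y = hypCoeff a N := ⟨_, rfl⟩
  rw [← hyN] at hy hε
  have hε' : (q + 2) * ((N + 1 + a) * y) ≤ 1 / 20 := by
    have := mul_le_mul_of_nonneg_left hε (by linarith : 0 ≤ q + 2)
    refine this.trans (le_of_eq ?_)
    field_simp
  obtain ⟨f, hf⟩ : ∃ f, f = (2 * N + 3 + 2 * a) * (N + 1 + a) * y / (2 * q + 4 * N + 8) :=
    ⟨_, rfl⟩
  have hf0 : 0 < f := by rw [hf]; positivity
  have hfj : 2 * f ≤ (N + 1 + a) * y := by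
    rw [hf, ← mul_div_assoc, div_le_iff₀ (by positivity)]
    have : 0 < (N + 1 + a) * y := by positivity
    nlinarith
  have hfeq : (2 * q + 4 * N + 8) * f = (2 * N + 3 + 2 * a) * (N + 1 + a) * y := by
    rw [hf]
    field_simp
  obtain ⟨c, hc⟩ : ∃ c, c = 3 / (2 * (q + 2)) := ⟨_, rfl⟩
  have hceq : 2 * (q + 2) * c = 3 := by
    rw [hc]
    field_simp
  have hκ : (3 - 2 * c) * (1 + 2 * a) = 3 * (1 + a) := by
    linear_combination (-a) * hceq + 2 * c * haq
  obtain ⟨r, hr⟩ : ∃ r, r = hypSum a N := ⟨_, rfl⟩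
  have hrc : ContDiff ℝ (⊤ : ℕ∞) r := hr ▸ contDiff_hypSum a N
  have dr : ∀ s, HasDerivAt r (deriv r s) s :=
    fun s => (hrc.differentiable (by simp) s).hasDerivAt
  have dr1 : ∀ s, HasDerivAt (deriv r) (deriv (deriv r) s) s :=
    fun s => ((contDiff_deriv hrc).differentiable (by simp) s).hasDerivAt
  have hrc1 := contDiff_deriv hrc
  have hode : ∀ z, _ := hypSum_ode a N
  rw [← hr, ← hyN] at hode
  let F : ℝ → ℝ := fun z => c - f * z ^ (N + 1)
  let X : ℝ → ℝ := fun z => z * deriv r z + 5 / 2 * r z + (q + 2) * f * z ^ N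
  let G : ℝ → ℝ := fun z => -(1 + a) + (1 / 2 - a) * (z * r z) + (q + 2) * f * z ^ (N + 1)
  let K : ℝ → ℝ := fun z => 3 - 2 * c - 2 * (1 + a) * z +
    (5 / 2 * z - (3 / 2 + 2 * a) * z ^ 2) * r z + (z ^ 2 - z ^ 3) * deriv r z -
    q * f * z ^ (N + 1) + (q + 2) * f * z ^ (N + 2)
  have dF : ∀ z, deriv F z = -f * (N + 1) * z ^ N := fun z => by
    have h1 : HasDerivAt F _ z := ((hasDerivAt_pow (N + 1) z).const_mul f).const_sub c
    rw [h1.deriv]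
    simp
    ring
  have dX : ∀ z, z * deriv X z = z ^ 2 * deriv (deriv r) z + 7 / 2 * (z * deriv r z) +
      (q + 2) * f * N * z ^ N := fun z => by
    have h1 : HasDerivAt X _ z := (((hasDerivAt_id z).mul (dr1 z)).add
      ((dr z).const_mul (5 / 2))).add ((hasDerivAt_pow N z).const_mul ((q + 2) * f))
    rw [h1.deriv]
    simp
    linear_combination (q + 2) * f * mul_natCast_mul_pow_pred N z
  have dG : ∀ z, deriv G z = (1 / 2 - a) * (r z + z * deriv r z) +
      (q + 2) * f * (N + 1) * z ^ N := fun z => by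
    have h1 : HasDerivAt G _ z := ((((hasDerivAt_id z).mul (dr z)).const_mul (1 / 2 - a)).const_add
      (-(1 + a))).add ((hasDerivAt_pow (N + 1) z).const_mul ((q + 2) * f))
    rw [h1.deriv]
    simp
    ring
  have dK : ∀ z, deriv K z = -2 * (1 + a) + (5 / 2 - (3 + 4 * a) * z) * r z +
      (9 / 2 * z - (9 / 2 + 2 * a) * z ^ 2) * deriv r z + (z ^ 2 - z ^ 3) * deriv (deriv r) z -
      q * f * (N + 1) * z ^ N + (q + 2) * f * (N + 2) * z ^ (N + 1) := fun z => by
    have h1 : HasDerivAt K _ z := (((((((hasDerivAt_id z).const_mul (2 * (1 + a))).const_sub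
      (3 - 2 * c)).add ((((hasDerivAt_id z).const_mul (5 / 2)).sub
      ((hasDerivAt_pow 2 z).const_mul (3 / 2 + 2 * a))).mul (dr z))).add
      (((hasDerivAt_pow 2 z).sub (hasDerivAt_pow 3 z)).mul (dr1 z))).sub
      ((hasDerivAt_pow (N + 1) z).const_mul (q * f))).add
      ((hasDerivAt_pow (N + 2) z).const_mul ((q + 2) * f)))
    rw [h1.deriv]
    simp
    ring
  have hklow : ∀ z ∈ Set.Icc (0 : ℝ) 1, 1 / 2 ≤ 3 / (1 + 2 * a) - (5 / 4 - a / 2) * z := by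
    intro z hz
    have h1 : 7 / 4 - a / 2 ≤ 3 / (1 + 2 * a) := by
      rw [le_div_iff₀ (by linarith)]
      nlinarith
    have h2 : (5 / 4 - a / 2) * z ≤ 5 / 4 - a / 2 := mul_le_of_le_one_right (by linarith) hz.2
    linarith
  have hKlow : ∀ z ∈ Set.Icc (0 : ℝ) 1,
      19 / 20 * (1 + a) * (3 / (1 + 2 * a) - (5 / 4 - a / 2) * z) ≤ K z := by
    intro z hz
    have h1 := le_hypSum_combination ha ha' hz.1 (by omega : 1 ≤ N)
    rw [← hr, ← hyN] at h1
    have hp := pow_le_one₀ (n := N + 1) hz.1 hz.2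
    have h2 : (N + 1 / 2 + 2 * a) * y * z ^ (N + 1) ≤ (N + 1 + a) * y := by
      refine (mul_le_of_le_one_right (by positivity) hp).trans ?_
      gcongr ?_ * y
      linarith
    have h3 : q * f * z ^ (N + 1) ≤ q * f := mul_le_of_le_one_right (by positivity) hp
    have h4 : 0 ≤ (q + 2) * f * z ^ (N + 2) := by have := hz.1; positivity
    have h5 := mul_le_mul_of_nonneg_left hfj hq.le
    have h6 := mul_le_mul_of_nonneg_left (hklow z hz) (by linarith : 0 ≤ 1 + a)
    have h7 : 3 - 2 * c = (1 + a) * (3 / (1 + 2 * a)) := by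
      field_simp
      linear_combination hκ
    simp only [K]
    linear_combination h1 + h2 + h3 + h4 + h5 / 2 + h6 / 20 + ha / 40 - h7 + hε' / 2
  have hXlow : ∀ z ∈ Set.Icc (0 : ℝ) 1, 5 / 2 * hypCoeff a 1 + 7 / 2 * hypCoeff a 2 * z +
      9 / 2 * hypCoeff a 3 * z ^ 2 ≤ X z := by
    intro z hz
    have h1 := le_mul_deriv_hypSum_add ha hz.1 hN
    rw [← hr] at h1
    have h2 : 0 ≤ (q + 2) * f * z ^ N := by have := hz.1; positivity
    simp only [X]
    linarith
  have hqf : (q + 2) * f ≤ 1 / 40 := by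
    have := mul_le_mul_of_nonneg_left hfj (by linarith : 0 ≤ q + 2)
    linarith
  refine ⟨K, G, X, F, ?_, ?_, ?_, ?_, ?_, ?_, ?_, ?_, ?_, ?_⟩
  · fun_prop
  · fun_prop
  · fun_prop
  · fun_prop
  · intro z hz
    refine lt_of_lt_of_le ?_ (hKlow z hz)
    have := hklow z hz
    positivity
  · intro z hz
    have h1 : f * z ^ (N + 1) ≤ f := mul_le_of_le_one_right hf0.le (pow_le_one₀ hz.1 hz.2)
    have h2 : f < c := by
      refine lt_of_mul_lt_mul_left ?_ (by linarith : 0 ≤ q + 2)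
      linarith
    simp only [F]
    linarith
  · intro z hz
    have h1 := hypSum_le ha ha' hz.1 hz.2 N
    have h2 := mul_nonneg hz.1 (hypSum_nonneg ha hz.1 N)
    rw [← hr] at h1 h2
    rw [← hyN] at h1
    have h3 := mul_nonneg (by linarith : 0 ≤ 1 / 2 - a) h2
    have h4 : 0 ≤ ((N : ℝ) + 2) * y := by positivity
    have h5 : 0 ≤ (q + 2) * f * z ^ (N + 1) := by have := hz.1; positivity
    have h6 : (q + 2) * f * z ^ (N + 1) ≤ (q + 2) * f :=
      mul_le_of_le_one_right (by positivity) (pow_le_one₀ hz.1 hz.2)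
    have hGsq : G z ^ 2 ≤ (1 + a) ^ 2 := by
      refine sq_le_sq' ?_ ?_ <;> simp only [G] <;> linarith
    have hC : 0 ≤ 5 / 2 * hypCoeff a 1 + 7 / 2 * hypCoeff a 2 * z +
        9 / 2 * hypCoeff a 3 * z ^ 2 := by
      have := hz.1
      have := hypCoeff_pos ha 1
      have := hypCoeff_pos ha 2
      have := hypCoeff_pos ha 3
      positivity
    have hk := hklow z hz
    have hK0 : 0 ≤ 19 / 20 * (1 + a) * (3 / (1 + 2 * a) - (5 / 4 - a / 2) * z) := by positivity
    have h7 := mul_le_mul (hKlow z hz) (hXlow z hz) hC (hK0.trans (hKlow z hz))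
    have h8 := mul_le_mul_of_nonneg_left (quadratic_mul_le ha ha' hz.1 hz.2)
      (by linarith : 0 ≤ 19 / 20 * (1 + a))
    have h9 : 0 < (1 + a) ^ 2 := by positivity
    linear_combination hGsq + h7 + h8 + 7 / 50 * h9
  · intro z
    simp only [K, G, X, F]
    linear_combination hceq
  · intro z
    rw [dK, dG]
    simp only [K, G]
    linear_combination z * hode z + hκ + z * z ^ N * hfeq - 2 * f * z * z ^ N * haq
  · intro z
    have h1 := dX z
    rw [dK, dF]
    simp only [G]
    linear_combination -hode z - (1 - z) * h1 - z ^ N * hfeq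

/-- Theorem 2.1, first reduction.  For `d = 3`, `p > 5`, `m ≥ 40`, there is
a defocusing potential `F` homogeneous of order `p+1`, some `S > 0`, and a smooth
nowhere-vanishing `u : Γ₃ → ℝ^m \ {0}` (smooth meaning: smooth on an open neighbourhood `Ω`
of the cone) solving `□u = ∇F(u)` on `Γ₃` and discretely self-similar. -/
theorem stmt1 (p : ℝ) (hp : 5 < p) (m : ℕ) (hm : 40 ≤ m) :
    ∃ F : Em m → ℝ,
      -- `F` is a potential (smooth away from the origin)
      ContDiffOn ℝ (⊤ : ℕ∞) F {0}ᶜ ∧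
      -- defocusing
      (∀ v : Em m, v ≠ 0 → 0 < F v) ∧
      -- homogeneous of order `p+1`
      (∀ l : ℝ, 0 < l → ∀ v : Em m, F (l • v) = l ^ (p + 1) * F v) ∧
      ∃ S : ℝ, 0 < S ∧
      ∃ (u : Sp 3 → Em m) (Ω : Set (Sp 3)),
        IsOpen Ω ∧ Cone 3 ⊆ Ω ∧ ContDiffOn ℝ (⊤ : ℕ∞) u Ω ∧
        -- nowhere vanishing on the cone
        (∀ y ∈ Cone 3, u y ≠ 0) ∧
        -- solves the nonlinear wave system on the cone
        (∀ y ∈ Cone 3, dAlembert u y = gradient F (u y)) ∧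
        -- discrete self-similarity `u(e^S t, e^S x) = e^{-(2/(p-1))S} u(t,x)`
        (∀ y ∈ Cone 3, u (Real.exp S • y) = Real.exp (-(2 / (p - 1)) * S) • u y) := by
  have h1 : (0 : ℝ) < p - 1 := by linarith
  have ha' : 2 / (p - 1) < 1 / 2 := by
    rw [div_lt_div_iff₀ h1 two_pos]
    linarith
  have haq : 2 / (p - 1) * ((p - 1) / 2) = 1 := by field_simp
  obtain ⟨K, G, X, F, hK, hG, hX, hF, hKpos, hFpos, hKX, e0, e1, e2⟩ :=
    exists_densities (by positivity) ha' haq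
  exact exists_solution_of_densities (by linarith) rfl rfl (by omega) hK hG hX hF hKpos hFpos hKX
    e0 e1 e2
end
end

section
/- Let d, m ≥ 1 be integers and p > 1 a real number. Suppose there exist S > 0, a defocusing potential F : ℝ^m → ℝ homogeneous of order p+1, and a smooth nowhere-vanishing u : Γ_d → ℝ^m \ {0} solving □u = (∇F)(u) on Γ_d with u(e^S t, e^S x) = e^{−(2/(p−1))S} u(t,x) for all (t,x) ∈ Γ_d. Then there exists a defocusing smooth potential F̃ : ℝ^m → ℝ that is homogeneous of order p+1 outside of the unit ball, and smooth initial data u₀, u₁ : ℝ^d → ℝ^m, such that there is no global smooth solution v : ℝ^{1+d} → ℝ^m of □v = (∇F̃)(v) with v(0,·) = u₀ and ∂_t v(0,·) = u₁. -/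
open Real MeasureTheory
open scoped RealInnerProductSpace

noncomputable section

open Set Filter Topology

section PartialDerivatives

variable {d : ℕ} {E : Type*} [NormedAddCommGroup E] [NormedSpace ℝ E]

lemma ContDiff.pd {f : Sp d → E} (hf : ContDiff ℝ (⊤ : ℕ∞) f) (α : Fin (d + 1)) :
    ContDiff ℝ (⊤ : ℕ∞) (pd α f) :=
  (hf.fderiv_right (m := (⊤ : ℕ∞)) le_rfl).clm_apply contDiff_const

lemma Filter.EventuallyEq.pd {f g : Sp d → E} {y : Sp d} (h : f =ᶠ[𝓝 y] g) (α : Fin (d + 1)) :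
    pd α f =ᶠ[𝓝 y] pd α g :=
  (h.fderiv (𝕜 := ℝ)).mono fun x hx => by simp only [_root_.pd, hx]

lemma Filter.EventuallyEq.dAlembert_eq {f g : Sp d → E} {y : Sp d} (h : f =ᶠ[𝓝 y] g) :
    dAlembert f y = dAlembert g y := by
  simp only [dAlembert, ((h.pd _).pd _).eq_of_nhds]

lemma pd_neg (f : Sp d → E) (α : Fin (d + 1)) (y : Sp d) :
    pd α (fun x => -f x) y = -pd α f y := by
  simp [pd]

lemma pd_sub {f g : Sp d → E} (hf : Differentiable ℝ f) (hg : Differentiable ℝ g)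
    (α : Fin (d + 1)) : pd α (fun y => f y - g y) = fun y => pd α f y - pd α g y := by
  ext y
  simp only [pd]
  rw [fderiv_fun_sub (hf y) (hg y)]
  rfl

lemma dAlembert_sub {f g : Sp d → E} (hf : ContDiff ℝ (⊤ : ℕ∞) f) (hg : ContDiff ℝ (⊤ : ℕ∞) g)
    (y : Sp d) : dAlembert (fun y => f y - g y) y = dAlembert f y - dAlembert g y := by
  have hD : ∀ {h : Sp d → E}, ContDiff ℝ (⊤ : ℕ∞) h → Differentiable ℝ h :=
    fun hh => hh.differentiable (by simp)
  simp only [dAlembert, pd_sub (hD hf) (hD hg), pd_sub (hD (hf.pd _)) (hD (hg.pd _)),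
    Finset.sum_sub_distrib]
  abel

lemma pd_comm {f : Sp d → E} (hf : ContDiff ℝ (⊤ : ℕ∞) f) (α β : Fin (d + 1)) (y : Sp d) :
    pd α (pd β f) y = pd β (pd α f) y := by
  have hd : DifferentiableAt ℝ (fderiv ℝ f) y :=
    (hf.fderiv_right (m := (⊤ : ℕ∞)) le_rfl).differentiable (by simp) y
  have key : ∀ γ δ : Fin (d + 1), pd γ (pd δ f) y =
      fderiv ℝ (fderiv ℝ f) y (Pi.single γ 1) (Pi.single δ 1) := by
    intro γ δ
    change fderiv ℝ (fun x => fderiv ℝ f x (Pi.single δ 1)) y (Pi.single γ 1) = _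
    rw [fderiv_clm_apply hd (differentiableAt_const _)]
    simp
  rw [key, key]
  have h2 : minSmoothness ℝ 2 ≤ ((⊤ : ℕ∞) : WithTop ℕ∞) := by
    rw [minSmoothness_of_isRCLikeNormedField]
    exact WithTop.coe_le_coe.2 (le_top : (2 : ℕ∞) ≤ ⊤)
  exact (hf.contDiffAt.isSymmSndFDerivAt h2).eq _ _

lemma pd_mul {f g : Sp d → ℝ} {y : Sp d} (hf : DifferentiableAt ℝ f y)
    (hg : DifferentiableAt ℝ g y) (α : Fin (d + 1)) :
    pd α (fun x => f x * g x) y = f y * pd α g y + g y * pd α f y := by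
  simp only [pd]
  rw [fderiv_fun_mul hf hg]
  simp

lemma pd_eq_zero_of_slice {f : Sp d → E} (hf : Differentiable ℝ f) {y : Sp d} {i : Fin d}
    (h : ∀ᶠ s : ℝ in 𝓝 0, f (y + s • Pi.single i.succ 1) = 0) : pd i.succ f y = 0 := by
  rw [pd, ← (hf y).lineDeriv_eq_fderiv, lineDeriv]
  have : (fun s : ℝ => f (y + s • Pi.single i.succ 1)) =ᶠ[𝓝 0] fun _ => (0 : E) := h
  rw [this.deriv_eq]
  simp

end PartialDerivatives

section TimeReflection

variable {d : ℕ} {E : Type*} [NormedAddCommGroup E] [NormedSpace ℝ E]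

/-- The time reflection `(t, x) ↦ (T - t, x)`. -/
def timeReflect (T : ℝ) (y : Sp d) : Sp d := Fin.cons (T - y 0) fun i => y i.succ

lemma hasFDerivAt_timeReflect (T : ℝ) (y : Sp d) :
    HasFDerivAt (timeReflect T)
      (ContinuousLinearMap.pi (Fin.cons (-ContinuousLinearMap.proj (R := ℝ) 0)
        fun i => ContinuousLinearMap.proj i.succ) : Sp d →L[ℝ] Sp d) y := by
  rw [hasFDerivAt_pi']
  intro α
  refine Fin.cases ?_ (fun i => ?_) α
  · exact (hasFDerivAt_apply (𝕜 := ℝ) (0 : Fin (d + 1)) y).const_sub T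
  · exact hasFDerivAt_apply (𝕜 := ℝ) i.succ y

lemma contDiff_timeReflect (T : ℝ) : ContDiff ℝ (⊤ : ℕ∞) (timeReflect (d := d) T) := by
  rw [contDiff_pi]
  intro α
  refine Fin.cases ?_ (fun i => ?_) α
  · exact contDiff_const.sub (contDiff_apply ℝ ℝ _)
  · exact contDiff_apply ℝ ℝ _

lemma pd_zero_comp_timeReflect {f : Sp d → E} (hf : Differentiable ℝ f) (T : ℝ) (y : Sp d) :
    pd 0 (fun x => f (timeReflect T x)) y = -pd 0 f (timeReflect T y) := by
  have h := ((hf (timeReflect T y)).hasFDerivAt.comp y (hasFDerivAt_timeReflect T y)).fderiv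
  change fderiv ℝ (f ∘ timeReflect T) y _ = _
  rw [h, pd, ← map_neg, ContinuousLinearMap.comp_apply]
  congr 1
  ext α
  refine Fin.cases ?_ (fun i => ?_) α <;> simp

lemma pd_succ_comp_timeReflect {f : Sp d → E} (hf : Differentiable ℝ f) (T : ℝ) (y : Sp d)
    (i : Fin d) :
    pd i.succ (fun x => f (timeReflect T x)) y = pd i.succ f (timeReflect T y) := by
  have h := ((hf (timeReflect T y)).hasFDerivAt.comp y (hasFDerivAt_timeReflect T y)).fderiv
  change fderiv ℝ (f ∘ timeReflect T) y _ = _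
  rw [h, pd, ContinuousLinearMap.comp_apply]
  congr 1
  ext α
  refine Fin.cases ?_ (fun j => ?_) α <;> simp [Pi.single_apply]

lemma dAlembert_comp_timeReflect {f : Sp d → E} (hf : ContDiff ℝ (⊤ : ℕ∞) f) (T : ℝ) (y : Sp d) :
    dAlembert (fun x => f (timeReflect T x)) y = dAlembert f (timeReflect T y) := by
  have hD : ∀ {h : Sp d → E}, ContDiff ℝ (⊤ : ℕ∞) h → Differentiable ℝ h :=
    fun hh => hh.differentiable (by simp)
  have h0 : pd 0 (fun x => f (timeReflect T x)) = fun x => -pd 0 f (timeReflect T x) :=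
    funext (pd_zero_comp_timeReflect (hD hf) T)
  have h1 : ∀ i : Fin d, pd i.succ (fun x => f (timeReflect T x)) =
      fun x => pd i.succ f (timeReflect T x) :=
    fun i => funext fun x => pd_succ_comp_timeReflect (hD hf) T x i
  have hneg := pd_zero_comp_timeReflect (f := fun x => -pd 0 f x) (hD (hf.pd 0).neg) T y
  simp only [dAlembert, h0, h1, hneg, pd_succ_comp_timeReflect (hD (hf.pd _)), pd_neg,
    neg_neg]

end TimeReflection

section Divergence

variable {d : ℕ}

lemma integral_divergence_eq_zero {f : Fin (d + 1) → Sp d → ℝ}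
    (hf : ∀ α, ContDiff ℝ (⊤ : ℕ∞) (f α)) {lo hi : Sp d} (hle : lo ≤ hi)
    (hlo : ∀ α, ∀ y ∈ Icc lo hi, y α = lo α → f α y = 0)
    (hhi : ∀ α, ∀ y ∈ Icc lo hi, y α = hi α → f α y = 0) :
    ∫ y in Icc lo hi, ∑ α, pd α (f α) y = 0 := by
  have hc : Continuous fun y => ∑ α, pd α (f α) y :=
    continuous_finsetSum _ fun α _ => ((hf α).pd α).continuous
  have h := integral_divergence_of_hasFDerivAt_off_countable' lo hi hle f
    (fun α => fderiv ℝ (f α)) ∅ countable_empty (fun α => (hf α).continuous.continuousOn)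
    (fun y _ α => ((hf α).differentiable (by simp) y).hasFDerivAt)
    (hc.continuousOn.integrableOn_compact isCompact_Icc)
  refine h.trans (Finset.sum_eq_zero fun α _ => ?_)
  have hmem : ∀ c ∈ Icc (lo α) (hi α), ∀ x ∈ Icc (lo ∘ α.succAbove) (hi ∘ α.succAbove),
      (α.insertNth c x : Sp d) ∈ Icc lo hi := by
    intro c hc x hx
    exact Fin.insertNth_mem_Icc.2 ⟨hc, hx⟩
  rw [setIntegral_eq_zero_of_forall_eq_zero, setIntegral_eq_zero_of_forall_eq_zero, sub_zero]
  · intro x hx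
    exact hlo α _ (hmem _ (left_mem_Icc.2 (hle α)) x hx) (by simp)
  · intro x hx
    exact hhi α _ (hmem _ (right_mem_Icc.2 (hle α)) x hx) (by simp)

lemma eq_zero_of_setIntegral_Icc_eq_zero {D : Sp d → ℝ} (hD : Continuous D) {lo hi : Sp d}
    (hnn : ∀ y ∈ Icc lo hi, 0 ≤ D y) (hint : ∫ y in Icc lo hi, D y = 0) {y : Sp d}
    (hy : ∀ α, lo α < y α ∧ y α < hi α) : D y = 0 := by
  rw [setIntegral_eq_zero_iff_of_nonneg_ae (ae_restrict_of_forall_mem measurableSet_Icc hnn)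
    (hD.continuousOn.integrableOn_compact isCompact_Icc)] at hint
  have hsub : (univ.pi fun α => Ioo (lo α) (hi α)) ⊆ Icc lo hi := fun x hx =>
    ⟨fun α => (hx α trivial).1.le, fun α => (hx α trivial).2.le⟩
  exact Measure.eqOn_open_of_ae_eq (ae_restrict_of_ae_restrict_of_subset hsub hint)
    (isOpen_set_pi finite_univ fun α _ => isOpen_Ioo) hD.continuousOn continuousOn_const
    (fun α _ => hy α)

end Divergence

section Energy

variable {d : ℕ} {E : Type*} [NormedAddCommGroup E] [InnerProductSpace ℝ E]

/-- The energy density `½ (∑_α |∂_α w|² + |w|²)`. -/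
def energyDensity (w : Sp d → E) (y : Sp d) : ℝ :=
  (∑ α, ⟪pd α w y, pd α w y⟫ + ⟪w y, w y⟫) / 2

/-- The energy current of `w` weighted by `ρ`. -/
def energyCurrent (ρ : Sp d → ℝ) (w : Sp d → E) : Fin (d + 1) → Sp d → ℝ :=
  Fin.cons (fun y => ρ y * energyDensity w y)
    fun i y => ρ y * -⟪pd 0 w y, pd i.succ w y⟫

lemma contDiff_energyDensity {w : Sp d → E} (hw : ContDiff ℝ (⊤ : ℕ∞) w) :
    ContDiff ℝ (⊤ : ℕ∞) (energyDensity w) :=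
  ((ContDiff.sum fun α _ => (hw.pd α).inner ℝ (hw.pd α)).add (hw.inner ℝ hw)).div_const 2

lemma contDiff_energyCurrent {ρ : Sp d → ℝ} {w : Sp d → E} (hρ : ContDiff ℝ (⊤ : ℕ∞) ρ)
    (hw : ContDiff ℝ (⊤ : ℕ∞) w) (α : Fin (d + 1)) :
    ContDiff ℝ (⊤ : ℕ∞) (energyCurrent ρ w α) := by
  refine Fin.cases ?_ (fun i => ?_) α
  · exact hρ.mul (contDiff_energyDensity hw)
  · exact hρ.mul ((hw.pd 0).inner ℝ (hw.pd i.succ)).neg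

lemma energyDensity_eq (w : Sp d → E) (y : Sp d) :
    energyDensity w y =
      (‖pd 0 w y‖ ^ 2 + ∑ i : Fin d, ‖pd i.succ w y‖ ^ 2 + ‖w y‖ ^ 2) / 2 := by
  simp only [energyDensity, real_inner_self_eq_norm_sq, Fin.sum_univ_succ]

lemma energyDensity_nonneg (w : Sp d → E) (y : Sp d) : 0 ≤ energyDensity w y := by
  rw [energyDensity_eq]
  positivity

lemma pd_inner {f g : Sp d → E} (hf : Differentiable ℝ f) (hg : Differentiable ℝ g)
    (α : Fin (d + 1)) (y : Sp d) :
    pd α (fun x => ⟪f x, g x⟫) y = ⟪f y, pd α g y⟫ + ⟪pd α f y, g y⟫ :=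
  fderiv_inner_apply ℝ (hf y) (hg y) _

lemma pd_inner_self {f : Sp d → E} (hf : Differentiable ℝ f) (α : Fin (d + 1)) (y : Sp d) :
    pd α (fun x => ⟪f x, f x⟫) y = 2 * ⟪f y, pd α f y⟫ := by
  rw [pd_inner hf hf, real_inner_comm (f y) (pd α f y), two_mul]

lemma pd_energyDensity {w : Sp d → E} (hw : ContDiff ℝ (⊤ : ℕ∞) w) (β : Fin (d + 1)) (y : Sp d) :
    pd β (energyDensity w) y = ∑ α, ⟪pd α w y, pd β (pd α w) y⟫ + ⟪w y, pd β w y⟫ := by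
  have hD : ∀ {h : Sp d → E}, ContDiff ℝ (⊤ : ℕ∞) h → Differentiable ℝ h :=
    fun hh => hh.differentiable (by simp)
  have h1 : ∀ α, DifferentiableAt ℝ (fun x => ⟪pd α w x, pd α w x⟫) y := fun α =>
    ((hD (hw.pd α)).inner ℝ (hD (hw.pd α))) y
  have h2 : DifferentiableAt ℝ (fun x => ⟪w x, w x⟫) y := ((hD hw).inner ℝ (hD hw)) y
  have key : pd β (energyDensity w) y =
      (∑ α, pd β (fun x => ⟪pd α w x, pd α w x⟫) y + pd β (fun x => ⟪w x, w x⟫) y) / 2 := by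
    have h3 := ((HasFDerivAt.fun_sum (u := Finset.univ) fun α _ => (h1 α).hasFDerivAt).add
      h2.hasFDerivAt).mul_const (2 : ℝ)⁻¹
    change fderiv ℝ (fun y => (∑ α, ⟪pd α w y, pd α w y⟫ + ⟪w y, w y⟫) / 2) y _ = _
    simp only [div_eq_mul_inv]
    erw [h3.fderiv]
    simp only [pd, smul_apply, add_apply, sum_apply, smul_eq_mul]
    ring
  rw [key, pd_inner_self (hD hw), Finset.sum_congr rfl fun α _ => pd_inner_self (hD (hw.pd α)) β y,
    ← Finset.mul_sum]
  ring

lemma divergence_energyCurrent {ρ : Sp d → ℝ} {w : Sp d → E} (hρ : ContDiff ℝ (⊤ : ℕ∞) ρ)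
    (hw : ContDiff ℝ (⊤ : ℕ∞) w) (y : Sp d) :
    ∑ α, pd α (energyCurrent ρ w α) y =
      pd 0 ρ y * energyDensity w y
        - ∑ i : Fin d, pd i.succ ρ y * ⟪pd 0 w y, pd i.succ w y⟫
        + ρ y * (⟪w y, pd 0 w y⟫ - ⟪pd 0 w y, dAlembert w y⟫) := by
  have hi : ∀ i : Fin d, pd i.succ (fun x => -⟪pd 0 w x, pd i.succ w x⟫) y =
      -(⟪pd 0 w y, pd i.succ (pd i.succ w) y⟫ + ⟪pd 0 (pd i.succ w) y, pd i.succ w y⟫) := by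
    intro i
    rw [pd_comm hw 0 i.succ, ← pd_inner (hw.pd 0 |>.differentiable (by simp))
      (hw.pd i.succ |>.differentiable (by simp))]
    exact pd_neg _ _ _
  have hm : ∀ i : Fin d, pd i.succ (fun x => ρ x * -⟪pd 0 w x, pd i.succ w x⟫) y =
      ρ y * pd i.succ (fun x => -⟪pd 0 w x, pd i.succ w x⟫) y +
        -⟪pd 0 w y, pd i.succ w y⟫ * pd i.succ ρ y := fun i =>
    pd_mul (hρ.differentiable (by simp) y)
      (((hw.pd 0).inner ℝ (hw.pd i.succ)).neg.differentiable (by simp) y) i.succ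
  rw [Fin.sum_univ_succ]
  simp only [energyCurrent, Fin.cons_zero, Fin.cons_succ]
  rw [pd_mul (hρ.differentiable (by simp) y)
    ((contDiff_energyDensity hw).differentiable (by simp) y), pd_energyDensity hw]
  simp only [hm, hi, Fin.sum_univ_succ, dAlembert, inner_add_right, inner_neg_right, inner_sum]
  simp only [mul_neg, neg_mul, Finset.sum_add_distrib, Finset.sum_neg_distrib, mul_add, mul_sub,
    Finset.mul_sum, mul_comm (⟪pd 0 w y, pd _ w y⟫)]
  simp only [real_inner_comm (pd 0 (pd _ w) y)]
  ring

end Energy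

section FiniteSpeed

variable {d : ℕ} {E : Type*} [NormedAddCommGroup E] [InnerProductSpace ℝ E]

/-- The Lorentzian quadratic form `(t - a)² - |x|²` centred at `(a, 0)`. -/
def coneForm (a : ℝ) (y : Sp d) : ℝ := (y 0 - a) ^ 2 - ∑ i : Fin d, y i.succ ^ 2

/-- A smooth weight supported in the double light cone with apex `(a, 0)`. -/
def coneWeight (a c : ℝ) (y : Sp d) : ℝ := exp (c * y 0) * expNegInvGlue (coneForm a y)

lemma contDiff_coneForm (a : ℝ) : ContDiff ℝ (⊤ : ℕ∞) (coneForm (d := d) a) :=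
  (((contDiff_apply ℝ ℝ _).sub contDiff_const).pow 2).sub
    (ContDiff.sum fun _ _ => (contDiff_apply ℝ ℝ _).pow 2)

lemma contDiff_coneWeight (a c : ℝ) : ContDiff ℝ (⊤ : ℕ∞) (coneWeight (d := d) a c) :=
  (contDiff_const.mul (contDiff_apply ℝ ℝ _)).exp.mul
    (expNegInvGlue.contDiff.comp (contDiff_coneForm a))

lemma hasFDerivAt_coneForm (a : ℝ) (y : Sp d) :
    HasFDerivAt (coneForm a)
      ((2 * (y 0 - a)) • ContinuousLinearMap.proj (R := ℝ) (φ := fun _ : Fin (d + 1) => ℝ) 0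
        - ∑ i : Fin d, (2 * y i.succ) •
          ContinuousLinearMap.proj (R := ℝ) (φ := fun _ : Fin (d + 1) => ℝ) i.succ) y := by
  have h0 := ((hasFDerivAt_apply (𝕜 := ℝ) (0 : Fin (d + 1)) y).sub_const a).pow 2
  have h1 : ∀ i : Fin d, _ := fun i => (hasFDerivAt_apply (𝕜 := ℝ) i.succ y).pow 2
  have h2 : HasFDerivAt (coneForm a) _ y :=
    h0.sub (HasFDerivAt.fun_sum (u := Finset.univ) fun i _ => h1 i)
  refine h2.congr_fderiv ?_
  simp

lemma hasFDerivAt_coneWeight (a c : ℝ) (y : Sp d) :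
    HasFDerivAt (coneWeight a c)
      (exp (c * y 0) • (deriv expNegInvGlue (coneForm a y) •
        ((2 * (y 0 - a)) • ContinuousLinearMap.proj (R := ℝ) (φ := fun _ : Fin (d + 1) => ℝ) 0
        - ∑ i : Fin d, (2 * y i.succ) •
          ContinuousLinearMap.proj (R := ℝ) (φ := fun _ : Fin (d + 1) => ℝ) i.succ)) +
        expNegInvGlue (coneForm a y) • (exp (c * y 0) • c •
          ContinuousLinearMap.proj (R := ℝ) (φ := fun _ : Fin (d + 1) => ℝ) 0)) y := by
  have h0 := ((hasFDerivAt_apply (𝕜 := ℝ) (0 : Fin (d + 1)) y).const_mul c).exp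
  have h1 : HasDerivAt expNegInvGlue (deriv expNegInvGlue (coneForm a y)) (coneForm a y) :=
    ((expNegInvGlue.contDiff (n := 1)).differentiable (by simp) _).hasDerivAt
  exact h0.mul (h1.comp_hasFDerivAt y (hasFDerivAt_coneForm a y))

lemma pd_zero_coneWeight (a c : ℝ) (y : Sp d) :
    pd 0 (coneWeight a c) y = exp (c * y 0) *
      (deriv expNegInvGlue (coneForm a y) * (2 * (y 0 - a)) +
        c * expNegInvGlue (coneForm a y)) := by
  rw [pd, (hasFDerivAt_coneWeight a c y).fderiv]
  simp
  ring

lemma pd_succ_coneWeight (a c : ℝ) (y : Sp d) (i : Fin d) :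
    pd i.succ (coneWeight a c) y =
      -(exp (c * y 0) * (deriv expNegInvGlue (coneForm a y) * (2 * y i.succ))) := by
  rw [pd, (hasFDerivAt_coneWeight a c y).fderiv]
  simp [Pi.single_apply]

lemma deriv_expNegInvGlue_of_neg {s : ℝ} (hs : s < 0) : deriv expNegInvGlue s = 0 := by
  have : expNegInvGlue =ᶠ[𝓝 s] fun _ => 0 :=
    (eventually_lt_nhds hs).mono fun x hx => expNegInvGlue.zero_of_nonpos hx.le
  rw [this.deriv_eq, deriv_const]

/-- The energy flux through a cone is dominated by the energy. -/
lemma energyFlux_nonneg (w : Sp d → E) {τ : ℝ} (hτ : 0 ≤ τ) {y : Sp d}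
    (hy : ∑ i : Fin d, y i.succ ^ 2 ≤ τ ^ 2) :
    0 ≤ τ * energyDensity w y + ∑ i : Fin d, y i.succ * ⟪pd 0 w y, pd i.succ w y⟫ := by
  set A := ‖pd 0 w y‖ ^ 2
  set B := ∑ i : Fin d, ‖pd i.succ w y‖ ^ 2
  set X := ∑ i : Fin d, y i.succ * ⟪pd 0 w y, pd i.succ w y⟫
  have hA : 0 ≤ A := by positivity
  have hB : 0 ≤ B := by positivity
  have hX : X ^ 2 ≤ τ ^ 2 * (A * B) := by
    refine (Finset.sum_mul_sq_le_sq_mul_sq _ _ _).trans ?_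
    refine mul_le_mul hy ?_ (by positivity) (by positivity)
    rw [Finset.mul_sum]
    refine Finset.sum_le_sum fun i _ => ?_
    rw [← mul_pow]
    exact sq_le_sq' (neg_le_of_abs_le (abs_real_inner_le_norm _ _)) (real_inner_le_norm _ _)
  have hX' : |X| ≤ τ * ((A + B) / 2) := by
    refine abs_le_of_sq_le_sq (hX.trans ?_) (by positivity)
    rw [mul_pow]
    gcongr
    nlinarith [sq_nonneg (A - B)]
  have he : (A + B) / 2 ≤ energyDensity w y := by
    rw [energyDensity_eq]
    have : 0 ≤ ‖w y‖ ^ 2 := by positivity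
    linarith
  have := mul_le_mul_of_nonneg_left he hτ
  linarith [neg_le_of_abs_le hX']

lemma inner_source_le (w : Sp d → E) {L : ℝ} {y : Sp d} (hL : ‖dAlembert w y‖ ≤ L * ‖w y‖) :
    -((|L| + 1) * energyDensity w y) ≤ ⟪w y, pd 0 w y⟫ - ⟪pd 0 w y, dAlembert w y⟫ := by
  have h1 : |⟪w y, pd 0 w y⟫| ≤ ‖w y‖ * ‖pd 0 w y‖ := abs_real_inner_le_norm _ _
  have h2 : ⟪pd 0 w y, dAlembert w y⟫ ≤ ‖pd 0 w y‖ * (|L| * ‖w y‖) :=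
    (real_inner_le_norm _ _).trans (by
      gcongr
      exact hL.trans (by gcongr; exact le_abs_self L))
  have he : ‖w y‖ * ‖pd 0 w y‖ ≤ energyDensity w y := by
    rw [energyDensity_eq]
    have : 0 ≤ ∑ i : Fin d, ‖pd i.succ w y‖ ^ 2 := by positivity
    nlinarith [sq_nonneg (‖w y‖ - ‖pd 0 w y‖)]
  have h3 := mul_le_mul_of_nonneg_left he (abs_nonneg L)
  nlinarith [neg_le_of_abs_le h1]

lemma coneWeight_mul_energyDensity_le_divergence {w : Sp d → E} (hw : ContDiff ℝ (⊤ : ℕ∞) w)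
    {a L : ℝ} {y : Sp d} (hay : a ≤ y 0)
    (hL : ∑ i : Fin d, y i.succ ^ 2 ≤ (y 0 - a) ^ 2 → ‖dAlembert w y‖ ≤ L * ‖w y‖) :
    coneWeight a (|L| + 2) y * energyDensity w y ≤
      ∑ α, pd α (energyCurrent (coneWeight a (|L| + 2)) w α) y := by
  rw [divergence_energyCurrent (contDiff_coneWeight _ _) hw, pd_zero_coneWeight]
  simp only [pd_succ_coneWeight, coneWeight]
  set g := exp ((|L| + 2) * y 0)
  have hg : 0 < g := exp_pos _
  rcases lt_or_ge (coneForm a y) 0 with hq | hq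
  · simp [expNegInvGlue.zero_of_nonpos hq.le, deriv_expNegInvGlue_of_neg hq]
  have hy : ∑ i : Fin d, y i.succ ^ 2 ≤ (y 0 - a) ^ 2 := sub_nonneg.1 hq
  set χ := expNegInvGlue (coneForm a y)
  set χ' := deriv expNegInvGlue (coneForm a y)
  have hχ : 0 ≤ χ := expNegInvGlue.nonneg _
  have hχ' : 0 ≤ χ' := expNegInvGlue.monotone.deriv_nonneg
  have h1 := mul_nonneg (mul_nonneg hg.le hχ') (energyFlux_nonneg w (sub_nonneg.2 hay) hy)
  have h2 := mul_le_mul_of_nonneg_left (inner_source_le w (hL hy)) (mul_nonneg hg.le hχ)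
  have h3 : ∑ i : Fin d, -(g * (χ' * (2 * y i.succ))) * ⟪pd 0 w y, pd i.succ w y⟫ =
      -(2 * (g * χ') * ∑ i : Fin d, y i.succ * ⟪pd 0 w y, pd i.succ w y⟫) := by
    rw [Finset.mul_sum, ← Finset.sum_neg_distrib]
    exact Finset.sum_congr rfl fun i _ => by ring
  rw [h3]
  linarith

/-- Finite speed of propagation (backwards in time): a function satisfying a linear differential
inequality on a truncated light cone, with vanishing Cauchy data on its base, vanishes inside. -/
theorem eq_zero_of_norm_dAlembert_le {w : Sp d → E} (hw : ContDiff ℝ (⊤ : ℕ∞) w)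
    {a b L : ℝ}
    (hL : ∀ y : Sp d, a ≤ y 0 → y 0 ≤ b → ∑ i : Fin d, y i.succ ^ 2 ≤ (y 0 - a) ^ 2 →
      ‖dAlembert w y‖ ≤ L * ‖w y‖)
    (hb : ∀ y : Sp d, y 0 = b → ∑ i : Fin d, y i.succ ^ 2 < (b - a) ^ 2 →
      w y = 0 ∧ pd 0 w y = 0)
    {y : Sp d} (hay : a < y 0) (hyb : y 0 < b)
    (hy : ∑ i : Fin d, y i.succ ^ 2 < (y 0 - a) ^ 2) : w y = 0 := by
  have hab : a < b := hay.trans hyb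
  set R : ℝ := b - a + 1 with hR
  set lo : Sp d := Fin.cons a fun _ => -R
  set hi : Sp d := Fin.cons b fun _ => R
  set ρ : Sp d → ℝ := coneWeight a (|L| + 2) with hρdef
  have hρ : ContDiff ℝ (⊤ : ℕ∞) ρ := contDiff_coneWeight _ _
  have hρ0 : ∀ z : Sp d, coneForm a z ≤ 0 → ρ z = 0 := fun z hz => by
    simp [hρdef, coneWeight, expNegInvGlue.zero_of_nonpos hz]
  have hcur : ∀ α (z : Sp d), ρ z = 0 → energyCurrent ρ w α z = 0 := fun α z hz => by
    refine Fin.cases ?_ (fun i => ?_) α <;> simp [energyCurrent, hz]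
  have hle : lo ≤ hi := fun α => by
    refine Fin.cases ?_ (fun i => ?_) α
    · exact hab.le
    · simp only [lo, hi, Fin.cons_succ]; linarith
  have hside : ∀ z ∈ Icc lo hi, ∀ i : Fin d, z i.succ ^ 2 = R ^ 2 → ρ z = 0 := by
    intro z hz i hzi
    refine hρ0 z (sub_nonpos.2 ?_)
    have h0 : a ≤ z 0 := hz.1 0
    have h1 : z 0 ≤ b := hz.2 0
    calc (z 0 - a) ^ 2 ≤ R ^ 2 := by gcongr; linarith
      _ = z i.succ ^ 2 := hzi.symm
      _ ≤ _ := Finset.single_le_sum (f := fun i : Fin d => z i.succ ^ 2)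
          (fun _ _ => sq_nonneg _) (Finset.mem_univ i)
  have hint : ∫ z in Icc lo hi, ∑ α, pd α (energyCurrent ρ w α) z = 0 := by
    refine integral_divergence_eq_zero (contDiff_energyCurrent hρ hw) hle ?_ ?_
    · intro α z hz hzα
      refine hcur α z ?_
      revert hzα
      refine Fin.cases (fun h => ?_) (fun i h => ?_) α
      · refine hρ0 z ?_
        have : z 0 = a := h
        simp only [coneForm, this, sub_self, ne_eq, OfNat.ofNat_ne_zero, not_false_eq_true,
          zero_pow, zero_sub, Left.neg_nonpos_iff]
        positivity
      · exact hside z hz i (by rw [h]; simp [lo])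
    · intro α z hz hzα
      revert hzα
      refine Fin.cases (fun h => ?_) (fun i h => ?_) α
      · have hzb : z 0 = b := h
        rcases le_or_gt (coneForm a z) 0 with hq | hq
        · exact hcur 0 z (hρ0 z hq)
        rw [coneForm, hzb, sub_pos] at hq
        have hpd : ∀ α, pd α w z = 0 := by
          intro α
          refine Fin.cases (hb z hzb hq).2 (fun i => ?_) α
          refine pd_eq_zero_of_slice (hw.differentiable (by simp)) ?_
          have hcont : Continuous fun s : ℝ =>
              ∑ j : Fin d, (z + s • Pi.single i.succ (1 : ℝ) : Sp d) j.succ ^ 2 := by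
            fun_prop
          have : ∀ᶠ s : ℝ in 𝓝 0,
              ∑ j : Fin d, (z + s • Pi.single i.succ (1 : ℝ) : Sp d) j.succ ^ 2 < (b - a) ^ 2 :=
            hcont.continuousAt.eventually_lt continuousAt_const (by simpa using hq)
          refine this.mono fun s hs => (hb _ ?_ hs).1
          simp [hzb]
        simp [energyCurrent, energyDensity, hpd, (hb z hzb hq).1]
      · exact hcur i.succ z (hside z hz i (by rw [h]; simp [hi]))
  have hlow : ∀ z ∈ Icc lo hi, ρ z * energyDensity w z ≤ ∑ α, pd α (energyCurrent ρ w α) z :=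
    fun z hz => coneWeight_mul_energyDensity_le_divergence hw (hz.1 0) (hL z (hz.1 0) (hz.2 0))
  have hρnn : ∀ z, 0 ≤ ρ z := fun z => mul_nonneg (exp_pos _).le (expNegInvGlue.nonneg _)
  have hbox : ∀ α, lo α < y α ∧ y α < hi α := by
    intro α
    refine Fin.cases ⟨hay, hyb⟩ (fun i => ?_) α
    have : |y i.succ| < R := by
      refine abs_lt_of_sq_lt_sq ?_ (by linarith)
      calc y i.succ ^ 2 ≤ _ := Finset.single_le_sum (f := fun i : Fin d => y i.succ ^ 2)
            (fun _ _ => sq_nonneg _) (Finset.mem_univ i)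
        _ < (y 0 - a) ^ 2 := hy
        _ ≤ R ^ 2 := by gcongr; linarith
    exact abs_lt.1 this
  have hD0 := eq_zero_of_setIntegral_Icc_eq_zero
    (continuous_finsetSum _ fun α _ => ((contDiff_energyCurrent hρ hw α).pd α).continuous)
    (fun z hz => (mul_nonneg (hρnn z) (energyDensity_nonneg w z)).trans (hlow z hz)) hint hbox
  have hprod : ρ y * energyDensity w y ≤ 0 :=
    (hlow y ⟨fun α => (hbox α).1.le, fun α => (hbox α).2.le⟩).trans_eq hD0
  have hρpos : 0 < ρ y := mul_pos (exp_pos _) (expNegInvGlue.pos_of_pos (sub_pos.2 hy))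
  have he : energyDensity w y ≤ 0 := nonpos_of_mul_nonpos_right hprod hρpos
  rw [energyDensity_eq] at he
  have h1 : 0 ≤ ‖pd 0 w y‖ ^ 2 := by positivity
  have h2 : 0 ≤ ∑ i : Fin d, ‖pd i.succ w y‖ ^ 2 := by positivity
  have h3 : ‖w y‖ ^ 2 ≤ 0 := by linarith
  exact norm_eq_zero.1 (pow_eq_zero_iff two_ne_zero |>.1 (le_antisymm h3 (by positivity)))

end FiniteSpeed

section Extension

open scoped Manifold

/-- A function that is smooth on an open neighbourhood of a compact set agrees, near that set,
with a globally smooth function. -/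
lemma exists_contDiff_eventuallyEq_of_isCompact {V E : Type*} [NormedAddCommGroup V]
    [NormedSpace ℝ V] [FiniteDimensional ℝ V] [NormedAddCommGroup E] [NormedSpace ℝ E]
    {u : V → E} {Ω K : Set V} (hΩ : IsOpen Ω) (hu : ContDiffOn ℝ (⊤ : ℕ∞) u Ω)
    (hK : IsCompact K) (hKΩ : K ⊆ Ω) :
    ∃ U : V → E, ContDiff ℝ (⊤ : ℕ∞) U ∧ ∀ y ∈ K, U =ᶠ[𝓝 y] u := by
  obtain ⟨K', hK', hKK', hK'Ω⟩ := exists_compact_between hK hΩ hKΩ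
  obtain ⟨χ, hχ1, hχ0, -⟩ := exists_contMDiffMap_one_nhds_of_subset_interior (n := (⊤ : ℕ∞))
    𝓘(ℝ, V) hK.isClosed hKK'
  have hχ : ContDiff ℝ (⊤ : ℕ∞) χ := χ.contMDiff.contDiff
  refine ⟨fun y => χ y • u y, contDiff_iff_contDiffAt.2 fun y => ?_, fun y hy => ?_⟩
  · by_cases hy : y ∈ Ω
    · exact hχ.contDiffAt.smul (hu.contDiffAt (hΩ.mem_nhds hy))
    · have h0 : (fun y => χ y • u y) =ᶠ[𝓝 y] fun _ => 0 := by
        filter_upwards [hK'.isClosed.isOpen_compl.mem_nhds fun h => hy (hK'Ω h)] with z hz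
        rw [hχ0 z hz, zero_smul]
      exact contDiffAt_const.congr_of_eventuallyEq h0
  · filter_upwards [(eventually_nhdsSet_iff_forall.1 hχ1) y hy] with z hz
    rw [hz, one_smul]

end Extension

section Potential

variable {V : Type*} [NormedAddCommGroup V] [InnerProductSpace ℝ V] [FiniteDimensional ℝ V]

/-- A potential that is smooth and positive away from the origin can be modified inside the ball
of radius `1 / 2` so that it becomes smooth everywhere. -/
lemma exists_smooth_potential_eq {F : V → ℝ} (hF : ContDiffOn ℝ (⊤ : ℕ∞) F {0}ᶜ)
    (hFpos : ∀ v, v ≠ 0 → 0 < F v) :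
    ∃ G : V → ℝ, ContDiff ℝ (⊤ : ℕ∞) G ∧ (∀ v, v ≠ 0 → 0 < G v) ∧
      ∀ v, 1 / 2 < ‖v‖ → G v = F v := by
  let b : ContDiffBump (0 : V) := ⟨1 / 4, 1 / 2, by norm_num, by norm_num⟩
  refine ⟨fun v => (1 - b v) * F v + b v, contDiff_iff_contDiffAt.2 fun v => ?_,
    fun v hv => ?_, fun v hv => ?_⟩
  · by_cases hv : v = 0
    · have h1 : (fun v => (1 - b v) * F v + b v) =ᶠ[𝓝 v] fun _ => 1 := by
        rw [hv]
        filter_upwards [b.eventuallyEq_one] with z hz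
        simp [hz]
      exact contDiffAt_const.congr_of_eventuallyEq h1
    · exact ((contDiffAt_const.sub b.contDiff.contDiffAt).mul
        (hF.contDiffAt (isOpen_compl_singleton.mem_nhds hv))).add b.contDiff.contDiffAt
  · have h0 : 0 ≤ b v := b.nonneg
    have h1 : b v ≤ 1 := b.le_one
    rcases h0.eq_or_lt with h | h
    · simpa [← h] using hFpos v hv
    · exact add_pos_of_nonneg_of_pos (mul_nonneg (sub_nonneg.2 h1) (hFpos v hv).le) h
  · have : b v = 0 := b.zero_of_le_dist (by simpa [b] using hv.le)
    simp [this]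

lemma contDiff_gradient {G : V → ℝ} (hG : ContDiff ℝ (⊤ : ℕ∞) G) :
    ContDiff ℝ (⊤ : ℕ∞) (gradient G) :=
  (InnerProductSpace.toDual ℝ V).symm.contDiff.comp (hG.fderiv_right (m := (⊤ : ℕ∞)) le_rfl)

lemma exists_gradient_lipschitz {G : V → ℝ} (hG : ContDiff ℝ (⊤ : ℕ∞) G) (R : ℝ) :
    ∃ L : ℝ, ∀ v w : V, ‖v‖ ≤ R → ‖w‖ ≤ R →
      ‖gradient G v - gradient G w‖ ≤ L * ‖v - w‖ := by
  have hloc : LocallyLipschitz (gradient G) :=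
    ((contDiff_gradient hG).of_le (by exact_mod_cast le_top)).locallyLipschitz
  obtain ⟨L, hL⟩ := (hloc.locallyLipschitzOn
    (s := Metric.closedBall 0 R)).exists_lipschitzOnWith_of_compact (isCompact_closedBall 0 R)
  refine ⟨L, fun v w hv hw => ?_⟩
  simpa [dist_eq_norm] using hL.dist_le_mul v (by simpa using hv) w (by simpa using hw)

end Potential

section SelfSimilar

variable {d : ℕ}

lemma isCompact_truncatedCone {a p q : ℝ} (hap : a ≤ p) :
    IsCompact {y : Sp d | p ≤ y 0 ∧ y 0 ≤ q ∧ ∑ i : Fin d, y i.succ ^ 2 ≤ (y 0 - a) ^ 2} := by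
  have hsub : {y : Sp d | p ≤ y 0 ∧ y 0 ≤ q ∧ ∑ i : Fin d, y i.succ ^ 2 ≤ (y 0 - a) ^ 2} ⊆
      Icc (Fin.cons p fun _ => -(q - a)) (Fin.cons q fun _ => q - a) := by
    rintro y ⟨hp, hq, hy⟩
    have key : ∀ i : Fin d, |y i.succ| ≤ q - a := fun i => by
      refine abs_le_of_sq_le_sq ?_ (by linarith)
      calc y i.succ ^ 2 ≤ _ := Finset.single_le_sum (f := fun i : Fin d => y i.succ ^ 2)
            (fun _ _ => sq_nonneg _) (Finset.mem_univ i)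
        _ ≤ (y 0 - a) ^ 2 := hy
        _ ≤ (q - a) ^ 2 := by gcongr; linarith
    constructor <;> intro α <;> refine Fin.cases ?_ (fun i => ?_) α
    exacts [hp, (abs_le.1 (key i)).1, hq, (abs_le.1 (key i)).2]
  refine isCompact_Icc.of_isClosed_subset ?_ hsub
  have h1 : IsClosed {y : Sp d | p ≤ y 0} := isClosed_le (by fun_prop) (by fun_prop)
  have h2 : IsClosed {y : Sp d | y 0 ≤ q} := isClosed_le (by fun_prop) (by fun_prop)
  have h3 : IsClosed {y : Sp d | ∑ i : Fin d, y i.succ ^ 2 ≤ (y 0 - a) ^ 2} :=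
    isClosed_le (by fun_prop) (by fun_prop)
  exact h1.inter (h2.inter h3)

lemma smul_mem_Cone {l : ℝ} (hl : 0 < l) {y : Sp d} (hy : y ∈ Cone d) : l • y ∈ Cone d := by
  refine ⟨mul_pos hl hy.1, ?_⟩
  simp only [Pi.smul_apply, smul_eq_mul, mul_pow, ← Finset.mul_sum]
  exact mul_le_mul_of_nonneg_left hy.2 (sq_nonneg l)

lemma single_mem_Cone {t : ℝ} (ht : 0 < t) : (Pi.single 0 t : Sp d) ∈ Cone d := by
  simp [Cone, ht, sq_nonneg]

variable {E : Type*} [NormedAddCommGroup E] [NormedSpace ℝ E]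

lemma selfSimilar_iterate {u : Sp d → E} {S σ : ℝ}
    (hss : ∀ y ∈ Cone d, u (exp S • y) = exp (-σ) • u y) (k : ℕ) :
    ∀ y ∈ Cone d, u (exp (k * S) • y) = exp (-(k * σ)) • u y := by
  induction k with
  | zero => simp
  | succ k ih =>
    intro y hy
    have h1 : exp ((k + 1 : ℕ) * S) • y = exp S • exp (k * S) • y := by
      rw [smul_smul, ← exp_add]
      congr 2
      push_cast
      ring
    rw [h1, hss _ (smul_mem_Cone (exp_pos _) hy), ih y hy, smul_smul, ← exp_add]
    congr 2
    push_cast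
    ring

/-- A nowhere-vanishing discretely self-similar function with `σ > 0` is large near the tip of
the cone. -/
lemma exists_norm_ge_of_selfSimilar {u : Sp d → E} {S σ : ℝ} (hS : 0 < S) (hσ : 0 < σ)
    (hu : ContinuousOn u (Cone d)) (hne : ∀ y ∈ Cone d, u y ≠ 0)
    (hss : ∀ y ∈ Cone d, u (exp S • y) = exp (-σ) • u y) (M : ℝ) :
    ∃ N : ℕ, ∀ y ∈ Cone d, y 0 ≤ exp (-(N * S)) → M ≤ ‖u y‖ := by
  set K : Set (Sp d) :=
    {y | 1 ≤ y 0 ∧ y 0 ≤ exp S ∧ ∑ i : Fin d, y i.succ ^ 2 ≤ (y 0 - 0) ^ 2}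
  have hKC : K ⊆ Cone d := fun y hy => ⟨zero_lt_one.trans_le hy.1, by simpa using hy.2.2⟩
  have hKne : K.Nonempty := ⟨Pi.single 0 1, by simp, by simp [hS.le], by simp⟩
  obtain ⟨y₀, hy₀, hmin⟩ := (isCompact_truncatedCone (d := d) (q := exp S)
    zero_le_one).exists_isMinOn hKne (hu.mono hKC).norm
  set c := ‖u y₀‖
  have hc : 0 < c := norm_pos_iff.2 (hne _ (hKC hy₀))
  obtain ⟨N, hN⟩ := exists_nat_ge (M / (c * σ))
  refine ⟨N, fun y hy hyN => ?_⟩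
  set k := ⌈-log (y 0) / S⌉₊
  have hk1 : -log (y 0) ≤ k * S := (div_le_iff₀ hS).1 (Nat.le_ceil _)
  have hlogN : N * S ≤ -log (y 0) := by
    have := log_le_log hy.1 hyN
    rw [log_exp] at this
    linarith
  have hk2 : k * S ≤ -log (y 0) + S := by
    have hnn : 0 ≤ -log (y 0) / S := div_nonneg (le_trans (by positivity) hlogN) hS.le
    have := (Nat.ceil_lt_add_one hnn).le
    calc k * S ≤ (-log (y 0) / S + 1) * S := by gcongr
      _ = _ := by field_simp
  have hNk : (N : ℝ) ≤ k := le_of_mul_le_mul_right (hlogN.trans hk1) hS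
  have hmem : exp (k * S) • y ∈ K := by
    have h0 : (exp (k * S) • y) 0 = exp (k * S + log (y 0)) := by
      rw [exp_add, exp_log hy.1]
      rfl
    refine ⟨?_, ?_, by simpa using (smul_mem_Cone (exp_pos _) hy).2⟩
    · rw [h0, one_le_exp_iff]; linarith
    · rw [h0, exp_le_exp]; linarith
  have h1 : c ≤ exp (-(k * σ)) * ‖u y‖ := by
    have : c ≤ ‖u (exp (k * S) • y)‖ := hmin hmem
    rwa [selfSimilar_iterate hss k y hy, norm_smul, norm_of_nonneg (exp_pos _).le] at this
  calc M ≤ N * (c * σ) := (div_le_iff₀ (by positivity)).1 hN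
    _ ≤ k * (c * σ) := by gcongr
    _ = (k * σ) * c := by ring
    _ ≤ exp (k * σ) * c := by gcongr; linarith [add_one_le_exp (k * σ)]
    _ ≤ exp (k * σ) * (exp (-(k * σ)) * ‖u y‖) := by gcongr
    _ = ‖u y‖ := by rw [← mul_assoc, ← exp_add]; simp

/-- A function that is continuous at the tip of the cone does not agree with a nowhere-vanishing
discretely self-similar function along the axis. -/
lemma not_eventually_eq_of_selfSimilar {u v : Sp d → E} {S σ : ℝ} (hS : 0 < S) (hσ : 0 < σ)
    (hne : ∀ y ∈ Cone d, u y ≠ 0)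
    (hss : ∀ y ∈ Cone d, u (exp S • y) = exp (-σ) • u y) (hv : Continuous v) :
    ¬ ∀ᶠ k : ℕ in atTop, v (Pi.single 0 (exp (-(k * S)))) = u (Pi.single 0 (exp (-(k * S)))) := by
  intro h
  have htop : ∀ τ : ℝ, 0 < τ → Tendsto (fun k : ℕ => (k : ℝ) * τ) atTop atTop := fun τ hτ =>
    tendsto_natCast_atTop_atTop.atTop_mul_const hτ
  have hlim : Tendsto (fun k : ℕ => v (Pi.single 0 (exp (-(k * S))))) atTop
      (𝓝 (v (Pi.single 0 0))) := by
    have h0 : Tendsto (fun k : ℕ => exp (-(k * S))) atTop (𝓝 0) :=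
      tendsto_exp_neg_atTop_nhds_zero.comp (htop S hS)
    exact ((hv.comp (continuous_single 0)).tendsto 0).comp h0
  have hdecay : Tendsto (fun k : ℕ => exp (-(k * σ)) • v (Pi.single 0 (exp (-(k * S))))) atTop
      (𝓝 0) := by
    simpa using (tendsto_exp_neg_atTop_nhds_zero.comp (htop σ hσ)).smul hlim
  have hconst : (fun k : ℕ => exp (-(k * σ)) • v (Pi.single 0 (exp (-(k * S))))) =ᶠ[atTop]
      fun _ => u (Pi.single 0 1) := by
    filter_upwards [h] with k hk
    rw [hk, ← selfSimilar_iterate hss k _ (single_mem_Cone (exp_pos _)), ← Pi.single_smul]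
    simp [← exp_add]
  exact hne _ (single_mem_Cone one_pos)
    (tendsto_nhds_unique (tendsto_const_nhds.congr' hconst.symm) hdecay)

end SelfSimilar

section Blowup

variable {d : ℕ} {V : Type*} [NormedAddCommGroup V] [InnerProductSpace ℝ V] [FiniteDimensional ℝ V]

/-- Solutions of `□u = ∇G(u)` on a truncated cone are determined by their data on its base. -/
lemma eq_of_dAlembert_eq_gradient {G : V → ℝ} (hG : ContDiff ℝ (⊤ : ℕ∞) G) {v u : Sp d → V}
    {Ω : Set (Sp d)} (hv : ContDiff ℝ (⊤ : ℕ∞) v) (hΩ : IsOpen Ω)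
    (hu : ContDiffOn ℝ (⊤ : ℕ∞) u Ω) {a b : ℝ}
    (hsub : {y : Sp d | a ≤ y 0 ∧ y 0 ≤ b ∧ ∑ i : Fin d, y i.succ ^ 2 ≤ (y 0 - a) ^ 2} ⊆ Ω)
    (hveq : ∀ y, dAlembert v y = gradient G (v y))
    (hueq : ∀ y : Sp d, a ≤ y 0 → y 0 ≤ b → ∑ i : Fin d, y i.succ ^ 2 ≤ (y 0 - a) ^ 2 →
      dAlembert u y = gradient G (u y))
    (hb : ∀ y : Sp d, y 0 = b → ∑ i : Fin d, y i.succ ^ 2 < (b - a) ^ 2 →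
      v y = u y ∧ pd 0 v y = pd 0 u y)
    {y : Sp d} (hay : a < y 0) (hyb : y 0 < b) (hy : ∑ i : Fin d, y i.succ ^ 2 < (y 0 - a) ^ 2) :
    v y = u y := by
  have hC := isCompact_truncatedCone (d := d) (q := b) (le_refl a)
  obtain ⟨U, hU, hUu⟩ := exists_contDiff_eventuallyEq_of_isCompact hΩ hu hC hsub
  obtain ⟨R₁, hR₁⟩ := hC.exists_bound_of_continuousOn hv.continuous.continuousOn
  obtain ⟨R₂, hR₂⟩ := hC.exists_bound_of_continuousOn hU.continuous.continuousOn
  obtain ⟨L, hL⟩ := exists_gradient_lipschitz hG (max R₁ R₂)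
  have hw : v y - U y = 0 := by
    refine eq_zero_of_norm_dAlembert_le (w := fun y => v y - U y) (hv.sub hU) (L := L)
      (fun z ha hb' hz => ?_) (fun z hz0 hz => ?_) hay hyb hy
    · have hmem : z ∈ {y : Sp d | a ≤ y 0 ∧ y 0 ≤ b ∧
          ∑ i : Fin d, y i.succ ^ 2 ≤ (y 0 - a) ^ 2} := ⟨ha, hb', hz⟩
      rw [dAlembert_sub hv hU, hveq, (hUu z hmem).dAlembert_eq, hueq z ha hb' hz,
        ← (hUu z hmem).eq_of_nhds]
      exact hL _ _ ((hR₁ z hmem).trans (le_max_left _ _)) ((hR₂ z hmem).trans (le_max_right _ _))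
    · have hmem : z ∈ {y : Sp d | a ≤ y 0 ∧ y 0 ≤ b ∧
          ∑ i : Fin d, y i.succ ^ 2 ≤ (y 0 - a) ^ 2} :=
        ⟨by linarith, hz0.le, by rw [hz0]; exact hz.le⟩
      obtain ⟨h1, h2⟩ := hb z hz0 hz
      refine ⟨by rw [(hUu z hmem).eq_of_nhds, h1, sub_self], ?_⟩
      rw [pd_sub (hv.differentiable (by simp)) (hU.differentiable (by simp))]
      beta_reduce
      rw [((hUu z hmem).pd 0).eq_of_nhds, h2, sub_self]
  have hmem : y ∈ {y : Sp d | a ≤ y 0 ∧ y 0 ≤ b ∧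
      ∑ i : Fin d, y i.succ ^ 2 ≤ (y 0 - a) ^ 2} := ⟨hay.le, hyb.le, hy.le⟩
  rw [← (hUu y hmem).eq_of_nhds]
  exact sub_eq_zero.1 hw

lemma contDiff_cons (t : ℝ) : ContDiff ℝ (⊤ : ℕ∞) fun x : Fin d → ℝ => (Fin.cons t x : Sp d) := by
  refine contDiff_pi.2 fun α => ?_
  refine Fin.cases ?_ (fun i => ?_) α
  · simpa using contDiff_const
  · simpa using contDiff_apply ℝ ℝ i

end Blowup

/-- Section 2: Theorem 2.1 implies Theorem 1.2.  If for some `d, m ≥ 1`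
and `p > 1` there is a discretely self-similar smooth nowhere-vanishing solution on the
cone `Γ_d` of `□u = ∇F(u)` for a defocusing potential `F` homogeneous of order `p+1`, then
there is a defocusing smooth potential `F̃`, homogeneous of order `p+1` outside the unit
ball, and smooth initial data admitting no global smooth solution. -/
theorem stmt2 (d m : ℕ) (hd : 1 ≤ d) (hm : 1 ≤ m) (p : ℝ) (hp : 1 < p)
    (F : Em m → ℝ)
    (hFsmooth : ContDiffOn ℝ (⊤ : ℕ∞) F {0}ᶜ)
    (hFpos : ∀ v : Em m, v ≠ 0 → 0 < F v)
    (hFhom : ∀ l : ℝ, 0 < l → ∀ v : Em m, F (l • v) = l ^ (p + 1) * F v)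
    (S : ℝ) (hS : 0 < S)
    (u : Sp d → Em m) (Ω : Set (Sp d)) (hΩ : IsOpen Ω) (hΩΓ : Cone d ⊆ Ω)
    (hu : ContDiffOn ℝ (⊤ : ℕ∞) u Ω)
    (hne : ∀ y ∈ Cone d, u y ≠ 0)
    (heq : ∀ y ∈ Cone d, dAlembert u y = gradient F (u y))
    (hss : ∀ y ∈ Cone d, u (Real.exp S • y) = Real.exp (-(2 / (p - 1)) * S) • u y) :
    ∃ Ft : Em m → ℝ,
      ContDiff ℝ (⊤ : ℕ∞) Ft ∧
      (∀ v : Em m, v ≠ 0 → 0 < Ft v) ∧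
      (∀ l : ℝ, 1 ≤ l → ∀ v : Em m, 1 ≤ ‖v‖ → Ft (l • v) = l ^ (p + 1) * Ft v) ∧
      ∃ u₀ u₁ : (Fin d → ℝ) → Em m,
        ContDiff ℝ (⊤ : ℕ∞) u₀ ∧ ContDiff ℝ (⊤ : ℕ∞) u₁ ∧
        ¬ ∃ v : Sp d → Em m,
            ContDiff ℝ (⊤ : ℕ∞) v ∧
            (∀ y : Sp d, dAlembert v y = gradient Ft (v y)) ∧
            (∀ x : Fin d → ℝ, v (Fin.cons (0 : ℝ) x) = u₀ x) ∧
            (∀ x : Fin d → ℝ, pd 0 v (Fin.cons (0 : ℝ) x) = u₁ x) := by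
  set σ := 2 / (p - 1) * S
  have hσ : 0 < σ := mul_pos (div_pos two_pos (sub_pos.2 hp)) hS
  replace hss : ∀ y ∈ Cone d, u (exp S • y) = exp (-σ) • u y := fun y hy => by
    rw [hss y hy, neg_mul]
  obtain ⟨G, hG, hGpos, hGF⟩ := exists_smooth_potential_eq hFsmooth hFpos
  have hgrad : ∀ v : Em m, 1 ≤ ‖v‖ → gradient G v = gradient F v := fun v hv => by
    refine Filter.EventuallyEq.gradient_eq ?_
    filter_upwards [(isOpen_lt continuous_const continuous_norm).mem_nhds
      (show (1 / 2 : ℝ) < ‖v‖ by linarith)] with w hw using hGF w hw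
  refine ⟨G, hG, hGpos, fun l hl v hv => ?_, ?_⟩
  · have hlv : 1 ≤ ‖l • v‖ := by
      rw [norm_smul, norm_of_nonneg (by linarith)]
      exact one_le_mul_of_one_le_of_one_le hl hv
    rw [hGF _ (by linarith), hGF v (by linarith), hFhom l (by linarith)]
  obtain ⟨N, hN⟩ := exists_norm_ge_of_selfSimilar hS hσ (hu.continuousOn.mono hΩΓ) hne hss 1
  set t₀ := exp (-(N * S))
  have ht₀ : 0 < t₀ := exp_pos _
  obtain ⟨U, hU, hUu⟩ := exists_contDiff_eventuallyEq_of_isCompact hΩ hu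
    (isCompact_truncatedCone (d := d) (q := t₀) ht₀.le) fun y hy =>
      hΩΓ ⟨ht₀.trans_le hy.1, by simpa using hy.2.2⟩
  refine ⟨fun x => U (Fin.cons t₀ x), fun x => -pd 0 U (Fin.cons t₀ x),
    hU.comp (contDiff_cons t₀), ((hU.pd 0).comp (contDiff_cons t₀)).neg, ?_⟩
  rintro ⟨v, hv, hveq, hv0, hv1⟩
  beta_reduce at hv0 hv1
  have hV : ContDiff ℝ (⊤ : ℕ∞) fun y => v (timeReflect t₀ y) := hv.comp (contDiff_timeReflect t₀)
  refine not_eventually_eq_of_selfSimilar hS hσ hne hss hV.continuous ?_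
  filter_upwards [eventually_gt_atTop N] with k hk
  set s := exp (-(k * S))
  have hs : 0 < s := exp_pos _
  have hst : s < t₀ := by
    refine exp_lt_exp.2 (neg_lt_neg ?_)
    gcongr
  have hcone : ∀ y : Sp d, s / 2 ≤ y 0 → ∑ i : Fin d, y i.succ ^ 2 ≤ (y 0 - s / 2) ^ 2 →
      y ∈ Cone d := fun y h0 hy =>
    ⟨by linarith, hy.trans (pow_le_pow_left₀ (by linarith) (by linarith) 2)⟩
  refine eq_of_dAlembert_eq_gradient hG hV hΩ hu (a := s / 2) (b := t₀)
    (fun y hy => hΩΓ (hcone y hy.1 hy.2.2)) (fun y => ?_) (fun y h0 hyt hy => ?_)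
    (fun y hy0 hy => ?_) ?_ ?_ ?_
  · rw [dAlembert_comp_timeReflect hv, hveq]
  · have hyC := hcone y h0 hy
    rw [heq y hyC, hgrad _ (hN y hyC hyt)]
  · have hyC : y ∈ Cone d := hcone y (by linarith) (by rw [hy0]; exact hy.le)
    have hyU : U =ᶠ[𝓝 y] u := hUu y ⟨hy0.ge, hy0.le, by simpa using hyC.2⟩
    have hrefl : timeReflect t₀ y = Fin.cons 0 fun i => y i.succ := by
      rw [timeReflect, hy0, sub_self]
    have hcons : (Fin.cons t₀ fun i => y i.succ : Sp d) = y := by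
      rw [← hy0]
      exact Fin.cons_self_tail y
    refine ⟨?_, ?_⟩
    · rw [hrefl, hv0, hcons, hyU.eq_of_nhds]
    · rw [pd_zero_comp_timeReflect (hv.differentiable (by simp)), hrefl, hv1, hcons, neg_neg,
        (hyU.pd 0).eq_of_nhds]
  · simpa using hs
  · simpa using hst
  · simpa using pow_pos (sub_pos.2 (half_lt_self hs)) 2
end
end
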